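/- arXiv:0903.1579 — 3 statements merged into one kernel-verified Lean document; each statement's English description precedes it below -/
import Mathlib

section
/- For any continuously differentiable function f on [N, N+M] whose derivative does not vanish, with X = sup_{y ∈ [N,N+M]} 1/|f'(y)|, and for any complex numbers b_m, the quantity ∫_{-T}^{T} Σ_{b ≤ B} Σ_{x mod b, (x,b)=1} |Σ_{N ≤ m < N+M} b_m e(xm/b) e(t f(m))|² dt is bounded by a constant times (B²T + X) Σ_{N ≤ m < N+M} |b_m|². -/
open Finset

noncomputable def e (z : ℝ) : ℂ := Complex.exp (2 * Real.pi * Complex.I * z)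

lemma e_add (x y : ℝ) : e (x + y) = e x * e y := by
  unfold e; rw [← Complex.exp_add]; push_cast; ring_nf

lemma e_norm (x : ℝ) : ‖e x‖ = 1 := by
  unfold e
  rw [show (2 * Real.pi * Complex.I * x : ℂ) = ((2 * Real.pi * x : ℝ) : ℂ) * Complex.I by
    push_cast; ring]
  exact Complex.norm_exp_ofReal_mul_I _

lemma e_conj (x : ℝ) : (starRingEnd ℂ) (e x) = e (-x) := by
  unfold e
  rw [← Complex.exp_conj]; simp [Complex.conj_ofNat]

lemma e_cont : Continuous e := by
  unfold e; fun_prop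

open MeasureTheory FourierTransform in
lemma exists_weight : ∃ (w : ℝ → ℝ) (η : ℝ), 0 < η ∧ Continuous w ∧ Integrable w ∧
    (∀ t, 0 ≤ w t) ∧ (∀ t ∈ Set.Icc (-η) η, 1 ≤ w t) ∧
    ∀ u : ℝ, 1 ≤ |u| → ∫ t, (w t : ℂ) * e (t * u) = 0 := by
  let φ : ContDiffBump (0 : ℝ) := ⟨1/8, 1/4, by norm_num, by norm_num⟩
  have hsup : ∀ x : ℝ, φ x ≠ 0 → |x| < 1/4 := by
    intro x hx
    have : x ∈ Function.support φ := hx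
    rw [φ.support_eq] at this
    simpa [φ] using this
  have hcd : ∀ u : ℝ, ContDiff ℝ (⊤ : ℕ∞) (fun x : ℝ => ((φ (x + u) : ℝ) : ℂ)) := by
    intro u
    exact Complex.ofRealCLM.contDiff.comp (φ.contDiff.comp (contDiff_id.add contDiff_const))
  have hcs : ∀ u : ℝ, HasCompactSupport (fun x : ℝ => ((φ (x + u) : ℝ) : ℂ)) := by
    intro u
    have h1 : HasCompactSupport (fun x : ℝ => φ (x + u)) :=
      φ.hasCompactSupport.comp_homeomorph (Homeomorph.addRight u)
    exact h1.comp_left (g := fun x : ℝ => (x : ℂ)) (by simp)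
  let S : ℝ → SchwartzMap ℝ ℂ := fun u => (hcs u).toSchwartzMap (hcd u)
  have hS : ∀ u x, S u x = ((φ (x + u) : ℝ) : ℂ) := fun u x => rfl
  have hF : ∀ u t, 𝓕 (S u) t = e (t * u) * 𝓕 (S 0) t := by
    intro u t
    rw [SchwartzMap.fourier_coe, SchwartzMap.fourier_coe, Real.fourier_real_eq_integral_exp_smul,
      Real.fourier_real_eq_integral_exp_smul, ← integral_const_mul]
    rw [← integral_add_right_eq_self _ (-u)]
    congr 1; ext x
    simp only [hS, smul_eq_mul, neg_add_cancel_right, add_zero, ← mul_assoc]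
    congr 1
    unfold e
    rw [← Complex.exp_add]; push_cast; ring_nf
  have hint : Integrable (fun t => ‖𝓕 (S 0) t‖ ^ 2) := by
    have := (𝓕 (S 0)).memLp 2 (μ := volume)
    exact this.integrable_norm_pow (by norm_num)
  have h0 : 0 < ‖𝓕 (S 0) 0‖ := by
    rw [norm_pos_iff, SchwartzMap.fourier_coe, Real.fourier_real_eq_integral_exp_smul]
    simp only [hS]
    simp only [mul_zero, zero_mul, Complex.ofReal_zero, Complex.exp_zero, one_smul, add_zero]
    rw [integral_complex_ofReal]
    have := φ.integral_pos (μ := volume)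
    exact_mod_cast this.ne'
  set a := ‖𝓕 (S 0) 0‖ with ha
  have hc : Continuous (fun t => ‖𝓕 (S 0) t‖) := (𝓕 (S 0)).continuous.norm
  have hev : ∀ᶠ t in nhds (0:ℝ), a / 2 < ‖𝓕 (S 0) t‖ :=
    hc.continuousAt.eventually_const_lt (by simp only [← ha]; linarith)
  obtain ⟨ε, hε, hb⟩ := Metric.eventually_nhds_iff.1 hev
  refine ⟨fun t => (2 / a) ^ 2 * ‖𝓕 (S 0) t‖ ^ 2, ε / 2, by positivity, by fun_prop,
    hint.const_mul _, fun t => by positivity, ?_, ?_⟩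
  · intro t ht
    have := hb (y := t) (by
      rw [Real.dist_eq, sub_zero]; exact (abs_le.2 ht).trans_lt (by linarith))
    show 1 ≤ (2 / a) ^ 2 * ‖𝓕 (S 0) t‖ ^ 2
    rw [← mul_pow]
    apply one_le_pow₀
    calc (1:ℝ) = 2 / a * (a / 2) := by field_simp
      _ ≤ _ := by gcongr
  · intro u hu
    have key := SchwartzMap.integral_inner_fourier_fourier (S 0) (S u)
    have z : ∀ x, inner ℂ (S 0 x) (S u x) = 0 := by
      intro x
      rw [hS, hS]
      by_cases h1 : φ (x + 0) = 0
      · rw [h1]; simp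
      by_cases h2 : φ (x + u) = 0
      · rw [h2]; simp
      have h1 := hsup _ h1
      have h2 := hsup _ h2
      have : |u| ≤ |x + u| + |x + 0| := by
        calc |u| = |(x + u) - (x + 0)| := by ring_nf
          _ ≤ _ := abs_sub _ _
      linarith
    simp only [z, integral_zero] at key
    have : ∀ t, (((2 / a) ^ 2 * ‖𝓕 (S 0) t‖ ^ 2 : ℝ) : ℂ) * e (t * u) =
        (((2 / a) ^ 2 : ℝ) : ℂ) * inner ℂ (𝓕 (S 0) t) (𝓕 (S u) t) := by
      intro t
      rw [hF u t, RCLike.inner_apply, mul_assoc (e (t * u)), Complex.mul_conj,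
        Complex.normSq_eq_norm_sq]
      push_cast; ring
    simp_rw [this]
    rw [integral_const_mul, key, mul_zero]

lemma expand_sq (s : Finset ℕ) (c : ℕ → ℂ) (g : ℕ → ℝ) (t : ℝ) :
    ((‖∑ m ∈ s, c m * e (t * g m)‖ ^ 2 : ℝ) : ℂ) =
      ∑ m ∈ s, ∑ n ∈ s, (c m * (starRingEnd ℂ) (c n)) * e (t * (g m - g n)) := by
  rw [← Complex.normSq_eq_norm_sq, ← Complex.mul_conj, map_sum, Finset.sum_mul_sum]
  refine Finset.sum_congr rfl fun m _ => Finset.sum_congr rfl fun n _ => ?_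
  rw [map_mul, e_conj, show t * (g m - g n) = t * g m + -(t * g n) by ring, e_add]
  ring

lemma int_e (k : ℤ) (hk : k ≠ 0) : ∫ t in (0:ℝ)..1, e (t * k) = 0 := by
  have hc : (2 * Real.pi * Complex.I * k : ℂ) ≠ 0 := by
    simp [Real.pi_ne_zero, hk]
  have : ∀ t : ℝ, e (t * k) = Complex.exp ((2 * Real.pi * Complex.I * k : ℂ) * t) := by
    intro t; unfold e; push_cast; ring_nf
  simp_rw [this]
  rw [integral_exp_mul_complex hc]
  have h1 : Complex.exp (2 * Real.pi * Complex.I * k : ℂ) = 1 := by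
    rw [Complex.exp_eq_one_iff]; exact ⟨k, by ring⟩
  simp [h1]

lemma parseval (s : Finset ℕ) (c : ℕ → ℂ) (K : ℕ) :
    ∫ t in (0:ℝ)..1, ‖∑ m ∈ s, c m * e (t * ((m : ℝ) - K))‖ ^ 2 = ∑ m ∈ s, ‖c m‖ ^ 2 := by
  apply Complex.ofReal_injective
  rw [← intervalIntegral.integral_ofReal]
  simp_rw [expand_sq s c (fun m => (m : ℝ) - K)]
  have hcont : ∀ (z : ℂ) (r : ℝ), IntervalIntegrable (fun t : ℝ => z * e (t * r))
      MeasureTheory.volume 0 1 := by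
    intro z r
    apply Continuous.intervalIntegrable
    exact continuous_const.mul (e_cont.comp (by fun_prop))
  rw [intervalIntegral.integral_finsetSum]
  · push_cast
    refine Finset.sum_congr rfl fun m hm => ?_
    rw [intervalIntegral.integral_finsetSum (fun n _ => hcont _ _)]
    rw [Finset.sum_eq_single m]
    · simp only [sub_self, mul_zero]
      rw [Complex.mul_conj, Complex.normSq_eq_norm_sq]
      simp [e]
    · intro n _ hn
      rw [intervalIntegral.integral_const_mul]
      have := int_e ((m : ℤ) - n) (by omega)
      push_cast at this
      simp only [sub_sub_sub_cancel_right]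
      rw [this, mul_zero]
    · intro h; exact absurd hm h
  · intro m _
    apply Continuous.intervalIntegrable
    refine continuous_finsetSum _ fun n _ => ?_
    exact continuous_const.mul (e_cont.comp (by fun_prop))

lemma sobolev (F F' : ℝ → ℂ) (hF : ∀ t, HasDerivAt F (F' t) t) (hF' : Continuous F')
    (α δ L : ℝ) (hδ : 0 < δ) (hL : 0 < L) :
    ‖F α‖ ^ 2 ≤ ∫ t in α..(α + δ), ((1 / δ + L) * ‖F t‖ ^ 2 + 1 / L * ‖F' t‖ ^ 2) := by
  have cF : Continuous F := continuous_iff_continuousAt.2 fun t => (hF t).continuousAt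
  have hd : ∀ t, HasDerivAt (fun t => ‖F t‖ ^ 2) (2 * inner ℝ (F t) (F' t)) t :=
    fun t => (hF t).norm_sq
  set k : ℝ → ℝ := fun t => L * ‖F t‖ ^ 2 + 1 / L * ‖F' t‖ ^ 2 with hk
  have ck : Continuous k := by fun_prop
  have k0 : ∀ t, 0 ≤ k t := fun t => by positivity
  have ci : Continuous (fun t => 2 * inner ℝ (F t) (F' t)) := by fun_prop
  have bk : ∀ t, - k t ≤ 2 * inner ℝ (F t) (F' t) := by
    intro t
    have h1 := neg_le_of_abs_le (abs_real_inner_le_norm (F t) (F' t))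
    have h2 : 2 * (‖F t‖ * ‖F' t‖) ≤ k t := by
      have : k t - 2 * (‖F t‖ * ‖F' t‖) = (L * ‖F t‖ - ‖F' t‖) ^ 2 / L := by
        simp only [hk]; field_simp; ring
      have : 0 ≤ k t - 2 * (‖F t‖ * ‖F' t‖) := by rw [this]; positivity
      linarith
    linarith
  have pt : ∀ β ∈ Set.Icc α (α + δ), ‖F α‖ ^ 2 ≤ ‖F β‖ ^ 2 + ∫ t in α..(α + δ), k t := by
    intro β hβ
    have h1 := intervalIntegral.integral_eq_sub_of_hasDerivAt (a := α) (b := β)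
      (fun t _ => hd t) (ci.intervalIntegrable _ _)
    have h2 : ∫ t in α..β, - k t ≤ ∫ t in α..β, 2 * inner ℝ (F t) (F' t) :=
      intervalIntegral.integral_mono_on hβ.1 (ck.neg.intervalIntegrable _ _)
        (ci.intervalIntegrable _ _) (fun t _ => bk t)
    rw [intervalIntegral.integral_neg] at h2
    have h3 : ∫ t in α..β, k t ≤ ∫ t in α..(α + δ), k t := by
      apply intervalIntegral.integral_mono_interval le_rfl hβ.1 hβ.2
      · exact Filter.Eventually.of_forall k0
      · exact ck.intervalIntegrable _ _
    linarith
  have h := intervalIntegral.integral_mono_on (a := α) (b := α + δ) (by linarith)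
    ((continuous_const (y := ‖F α‖ ^ 2)).intervalIntegrable (μ := MeasureTheory.volume) _ _)
    ((by fun_prop : Continuous fun β => ‖F β‖ ^ 2 + ∫ t in α..(α + δ), k t).intervalIntegrable _ _)
    pt
  rw [intervalIntegral.integral_const, intervalIntegral.integral_add
    ((by fun_prop : Continuous _).intervalIntegrable _ _)
    (continuous_const.intervalIntegrable _ _), intervalIntegral.integral_const] at h
  simp only [add_sub_cancel_left, smul_eq_mul] at h
  have e1 : ∫ t in α..(α + δ), ((1 / δ + L) * ‖F t‖ ^ 2 + 1 / L * ‖F' t‖ ^ 2) =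
      1 / δ * (∫ t in α..(α + δ), ‖F t‖ ^ 2) + ∫ t in α..(α + δ), k t := by
    rw [← intervalIntegral.integral_const_mul, ← intervalIntegral.integral_add
      ((by fun_prop : Continuous _).intervalIntegrable _ _) (ck.intervalIntegrable _ _)]
    congr 1; ext t; simp only [hk]; ring
  rw [e1]
  have : δ * ‖F α‖ ^ 2 ≤ δ * (1 / δ * (∫ t in α..(α + δ), ‖F t‖ ^ 2) + ∫ t in α..(α + δ), k t) := by
    refine h.trans (le_of_eq ?_); field_simp
  exact le_of_mul_le_mul_left this hδ

lemma sum_disjoint {ι : Type*} (R : Finset ι) (p : ι → ℝ) (δ : ℝ) (hδ : 0 < δ)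
    (h0 : ∀ r ∈ R, 0 ≤ p r ∧ p r + δ ≤ 1)
    (hsep : ∀ r ∈ R, ∀ r' ∈ R, r ≠ r' → δ ≤ |p r - p r'|)
    (h : ℝ → ℝ) (hc : Continuous h) (hn : ∀ t, 0 ≤ h t) :
    ∑ r ∈ R, ∫ t in (p r)..(p r + δ), h t ≤ ∫ t in (0:ℝ)..1, h t := by
  have e1 : ∀ r, ∫ t in (p r)..(p r + δ), h t = ∫ t in Set.Ioc (p r) (p r + δ), h t :=
    fun r => intervalIntegral.integral_of_le (by linarith)
  have io : ∀ a b, MeasureTheory.IntegrableOn h (Set.Ioc a b) :=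
    fun a b => hc.continuousOn.integrableOn_Icc.mono_set Set.Ioc_subset_Icc_self
  simp_rw [e1]
  rw [← MeasureTheory.integral_biUnion_finset R (fun _ _ => measurableSet_Ioc) ?_
    (fun _ _ => io _ _), intervalIntegral.integral_of_le zero_le_one]
  · apply MeasureTheory.setIntegral_mono_set (io _ _)
    · exact Filter.Eventually.of_forall hn
    · apply LE.le.eventuallyLE
      intro x hx
      simp only [Set.mem_iUnion] at hx
      obtain ⟨r, hr, hx⟩ := hx
      have := h0 r hr
      exact ⟨by linarith [hx.1], by linarith [hx.2]⟩
  · intro r hr r' hr' hne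
    rw [Function.onFun, Set.disjoint_left]
    intro x hx hx'
    have := hsep r hr r' hr' hne
    have h2 : |p r - p r'| < δ := by
      rw [abs_lt]; constructor <;> linarith [hx.1, hx.2, hx'.1, hx'.2]
    linarith

lemma large_sieve (s : Finset ℕ) (a : ℕ → ℂ) (K B : ℕ) (L : ℝ) (hL : 1 ≤ L)
    (hs : ∀ m ∈ s, |(m : ℝ) - K| ≤ L) :
    ∑ b ∈ Finset.Icc 1 B, ∑ x ∈ (Finset.range b).filter (fun x => Nat.Coprime x b),
      ‖∑ m ∈ s, a m * e ((x * m : ℕ) / (b : ℝ))‖ ^ 2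
      ≤ ((B : ℝ) ^ 2 + (1 + 4 * Real.pi ^ 2) * L) * ∑ m ∈ s, ‖a m‖ ^ 2 := by
  rcases Nat.eq_zero_or_pos B with rfl | hB
  · simp; positivity
  have hB' : (0:ℝ) < B := by exact_mod_cast hB
  rw [Finset.sum_sigma']
  set R := (Finset.Icc 1 B).sigma
    (fun b => (Finset.range b).filter (fun x => Nat.Coprime x b)) with hR
  set F : ℝ → ℂ := fun t => ∑ m ∈ s, a m * e (t * ((m : ℝ) - K)) with hFdef
  set c : ℕ → ℂ := fun m => a m * (2 * Real.pi * Complex.I * ((m : ℝ) - K : ℝ)) with hcdef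
  set F' : ℝ → ℂ := fun t => ∑ m ∈ s, c m * e (t * ((m : ℝ) - K)) with hF'def
  have cont : ∀ c : ℕ → ℂ, Continuous (fun t : ℝ => ∑ m ∈ s, c m * e (t * ((m : ℝ) - K))) := by
    intro c
    refine continuous_finsetSum _ fun n _ => ?_
    exact continuous_const.mul (e_cont.comp (by fun_prop))
  have hd : ∀ t, HasDerivAt F (F' t) t := by
    intro t
    refine HasDerivAt.fun_sum fun m _ => ?_
    have h1 : HasDerivAt (fun t : ℝ => (2 * Real.pi * Complex.I * ((m : ℝ) - K : ℝ) : ℂ) * (t : ℂ))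
        (2 * Real.pi * Complex.I * ((m : ℝ) - K : ℝ)) t := by
      simpa using (Complex.ofRealCLM.hasDerivAt (x := t)).const_mul
        (2 * Real.pi * Complex.I * ((m : ℝ) - K : ℝ) : ℂ)
    have h2 := (h1.cexp).const_mul (a m)
    have e1 : (fun t : ℝ => a m * e (t * ((m : ℝ) - K))) = fun t : ℝ =>
        a m * Complex.exp ((2 * Real.pi * Complex.I * ((m : ℝ) - K : ℝ) : ℂ) * (t : ℂ)) := by
      ext t; unfold e; push_cast; ring_nf
    have e2 : c m * e (t * ((m : ℝ) - K)) = a m * (Complex.exp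
        ((2 * Real.pi * Complex.I * ((m : ℝ) - K : ℝ) : ℂ) * (t : ℂ)) *
          (2 * Real.pi * Complex.I * ((m : ℝ) - K : ℝ))) := by
      simp only [hcdef]; unfold e; push_cast; ring_nf
    rw [e1, e2]
    exact h2
  have hnorm : ∀ b x : ℕ, ‖∑ m ∈ s, a m * e ((x * m : ℕ) / (b : ℝ))‖ = ‖F ((x : ℝ) / b)‖ := by
    intro b x
    have : ∑ m ∈ s, a m * e ((x * m : ℕ) / (b : ℝ)) = e ((x : ℝ) / b * K) * F ((x : ℝ) / b) := by
      simp only [hFdef]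
      rw [Finset.mul_sum]
      refine Finset.sum_congr rfl fun m _ => ?_
      rw [mul_left_comm, ← e_add]
      congr 2; push_cast; ring
    rw [this, norm_mul, e_norm, one_mul]
  set δ : ℝ := 1 / (B : ℝ) ^ 2 with hδ
  have hδ0 : 0 < δ := by positivity
  set h : ℝ → ℝ := fun t => (1 / δ + L) * ‖F t‖ ^ 2 + 1 / L * ‖F' t‖ ^ 2 with hh
  have cF : Continuous F := cont a
  have cF' : Continuous F' := cont c
  calc _ = ∑ r ∈ R, ‖F ((r.2 : ℝ) / r.1)‖ ^ 2 := by
        refine Finset.sum_congr rfl fun r _ => ?_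
        rw [hnorm]
    _ ≤ ∑ r ∈ R, ∫ t in ((r.2 : ℝ) / r.1)..((r.2 : ℝ) / r.1 + δ), h t :=
        Finset.sum_le_sum fun r _ => sobolev F F' hd cF' _ δ L hδ0 (by linarith)
    _ ≤ ∫ t in (0:ℝ)..1, h t := by
        refine sum_disjoint R (fun r => (r.2 : ℝ) / r.1) δ hδ0 ?_ ?_ h (by fun_prop)
          (fun t => by positivity)
        · rintro ⟨b, x⟩ hr
          simp only [hR, Finset.mem_sigma, Finset.mem_Icc, Finset.mem_filter,
            Finset.mem_range] at hr
          obtain ⟨⟨hb1, hbB⟩, hxb, -⟩ := hr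
          refine ⟨by positivity, ?_⟩
          have hb : (1:ℝ) ≤ b := by exact_mod_cast hb1
          have hbB : (b:ℝ) ≤ B := by exact_mod_cast hbB
          have hx : (x:ℝ) + 1 ≤ b := by exact_mod_cast hxb
          have h1 : δ ≤ 1 / b := by
            apply one_div_le_one_div_of_le (by linarith); nlinarith
          calc (x:ℝ) / b + δ ≤ x / b + 1 / b := by linarith
            _ = (x + 1) / b := by ring
            _ ≤ 1 := by rw [div_le_one (by linarith)]; exact hx
        · rintro ⟨b, x⟩ hr ⟨b', x'⟩ hr' hne
          simp only [hR, Finset.mem_sigma, Finset.mem_Icc, Finset.mem_filter,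
            Finset.mem_range] at hr hr'
          obtain ⟨⟨hb1, hbB⟩, hxb, hco⟩ := hr
          obtain ⟨⟨hb1', hbB'⟩, hxb', hco'⟩ := hr'
          have hb : (1:ℝ) ≤ b := by exact_mod_cast hb1
          have hbB : (b:ℝ) ≤ B := by exact_mod_cast hbB
          have hb' : (1:ℝ) ≤ b' := by exact_mod_cast hb1'
          have hbB' : (b':ℝ) ≤ B := by exact_mod_cast hbB'
          have hz : (x : ℤ) * b' - x' * b ≠ 0 := by
            intro h0
            have h0 : x * b' = x' * b := by
              have : (x : ℤ) * b' = x' * b := by linarith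
              exact_mod_cast this
            have d1 : b ∣ b' := hco.symm.dvd_of_dvd_mul_left (h0 ▸ Dvd.intro_left _ rfl)
            have d2 : b' ∣ b := hco'.symm.dvd_of_dvd_mul_left (h0 ▸ Dvd.intro_left _ rfl)
            have hbb := Nat.dvd_antisymm d1 d2
            subst hbb
            have : x = x' := Nat.eq_of_mul_eq_mul_right (by omega) h0
            subst this
            exact hne rfl
          have h1 : (1:ℝ) ≤ |(x:ℝ) * b' - x' * b| := by
            exact_mod_cast Int.one_le_abs hz
          have h2 : (x:ℝ) / b - x' / b' = (x * b' - x' * b) / (b * b') := by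
            field_simp
          show δ ≤ |(x:ℝ) / b - x' / b'|
          rw [h2, abs_div, abs_of_pos (by positivity : (0:ℝ) < b * b')]
          apply div_le_div₀ (by positivity) h1 (by positivity)
          nlinarith
    _ = (1 / δ + L) * ∑ m ∈ s, ‖a m‖ ^ 2 + 1 / L * ∑ m ∈ s, ‖c m‖ ^ 2 := by
        rw [← parseval s a K, ← parseval s c K, ← intervalIntegral.integral_const_mul,
          ← intervalIntegral.integral_const_mul, ← intervalIntegral.integral_add]
        · exact (by fun_prop : Continuous fun t => (1 / δ + L) * ‖F t‖ ^ 2).intervalIntegrable _ _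
        · exact (by fun_prop : Continuous fun t => 1 / L * ‖F' t‖ ^ 2).intervalIntegrable _ _
    _ ≤ (1 / δ + L) * ∑ m ∈ s, ‖a m‖ ^ 2 + 1 / L * ((2 * Real.pi * L) ^ 2 * ∑ m ∈ s, ‖a m‖ ^ 2) := by
        gcongr
        rw [Finset.mul_sum]
        refine Finset.sum_le_sum fun m hm => ?_
        have : ‖c m‖ = 2 * Real.pi * |(m:ℝ) - K| * ‖a m‖ := by
          simp only [hcdef, norm_mul, Complex.norm_real, Complex.norm_I, Real.norm_eq_abs,
            Complex.norm_ofNat, abs_of_pos Real.pi_pos]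
          ring
        rw [this, mul_pow]
        have := hs m hm
        have := Real.pi_pos
        gcongr
    _ = _ := by
        rw [hδ]; field_simp; ring

open MeasureTheory in
lemma integrable_w_mul (w : ℝ → ℝ) (hwi : Integrable w) (h : ℝ → ℝ) (hc : Continuous h) (D : ℝ)
    (hD : ∀ t, |h t| ≤ D) : Integrable (fun t => w t * h t) :=
  hwi.mul_bdd (c := D) hc.aestronglyMeasurable (Filter.Eventually.of_forall fun t => by
    rw [Real.norm_eq_abs]; exact hD t)

lemma poly_cont (s : Finset ℕ) (c : ℕ → ℂ) (g : ℕ → ℝ) :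
    Continuous (fun t : ℝ => ∑ m ∈ s, c m * e (t * g m)) := by
  refine continuous_finsetSum _ fun n _ => ?_
  exact continuous_const.mul (e_cont.comp (by fun_prop))

lemma poly_bound (s : Finset ℕ) (c : ℕ → ℂ) (g : ℕ → ℝ) (t : ℝ) :
    ‖∑ m ∈ s, c m * e (t * g m)‖ ≤ ∑ m ∈ s, ‖c m‖ := by
  refine (norm_sum_le _ _).trans (le_of_eq ?_)
  refine Finset.sum_congr rfl fun m _ => ?_
  rw [norm_mul, e_norm, mul_one]

open MeasureTheory in
lemma integrable_w_sq (w : ℝ → ℝ) (hwi : Integrable w) (s : Finset ℕ) (c : ℕ → ℂ) (g : ℕ → ℝ) :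
    Integrable (fun t => w t * ‖∑ m ∈ s, c m * e (t * g m)‖ ^ 2) := by
  refine integrable_w_mul w hwi _ ((poly_cont s c g).norm.pow 2) ((∑ m ∈ s, ‖c m‖) ^ 2) ?_
  intro t
  rw [abs_of_nonneg (by positivity)]
  have := poly_bound s c g t
  gcongr

open MeasureTheory in
lemma orth (w : ℝ → ℝ) (hwi : Integrable w)
    (hw0 : ∀ u : ℝ, 1 ≤ |u| → ∫ t, (w t : ℂ) * e (t * u) = 0)
    (s s' : Finset ℕ) (c : ℕ → ℂ) (g : ℕ → ℝ)
    (hsep : ∀ m ∈ s, ∀ n ∈ s', 1 ≤ |g n - g m|) :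
    ∫ t, w t * inner ℝ (∑ m ∈ s, c m * e (t * g m)) (∑ m ∈ s', c m * e (t * g m)) = 0 := by
  have hint : ∀ (z : ℂ) (u : ℝ), Integrable (fun t => z * ((w t : ℂ) * e (t * u))) := by
    intro z u
    refine Integrable.const_mul ?_ z
    refine (hwi.ofReal (𝕜 := ℂ)).mul_bdd (c := 1)
      ((e_cont.comp (by fun_prop : Continuous fun t : ℝ => t * u)).aestronglyMeasurable)
      (Filter.Eventually.of_forall fun t => (e_norm _).le)
  have e1 : ∀ t, (w t * inner ℝ (∑ m ∈ s, c m * e (t * g m)) (∑ m ∈ s', c m * e (t * g m)) : ℝ) =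
      RCLike.re (∑ n ∈ s', ∑ m ∈ s, (c n * (starRingEnd ℂ) (c m)) *
        ((w t : ℂ) * e (t * (g n - g m)))) := by
    intro t
    have : ∑ n ∈ s', ∑ m ∈ s, (c n * (starRingEnd ℂ) (c m)) * ((w t : ℂ) * e (t * (g n - g m))) =
      (w t : ℂ) * ((∑ n ∈ s', c n * e (t * g n)) *
        (starRingEnd ℂ) (∑ m ∈ s, c m * e (t * g m))) := by
      rw [map_sum, Finset.sum_mul_sum, Finset.mul_sum]
      refine Finset.sum_congr rfl fun n _ => ?_
      rw [Finset.mul_sum]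
      refine Finset.sum_congr rfl fun m _ => ?_
      rw [map_mul, e_conj, show t * (g n - g m) = t * g n + -(t * g m) by ring, e_add]
      ring
    rw [this, Complex.inner]
    simp [mul_comm]
  simp_rw [e1]
  rw [integral_re (integrable_finsetSum _ fun n _ => integrable_finsetSum _ fun m _ => hint _ _)]
  rw [integral_finsetSum _ fun n _ => integrable_finsetSum _ fun m _ => hint _ _]
  rw [Finset.sum_eq_zero, map_zero]
  intro n hn
  rw [integral_finsetSum _ fun m _ => hint _ _]
  refine Finset.sum_eq_zero fun m hm => ?_
  rw [integral_const_mul, hw0 _ (hsep m hm n hn), mul_zero]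

open MeasureTheory in
lemma block (w : ℝ → ℝ) (hwi : Integrable w) (hwn : ∀ t, 0 ≤ w t)
    (hw0 : ∀ u : ℝ, 1 ≤ |u| → ∫ t, (w t : ℂ) * e (t * u) = 0)
    (s : Finset ℕ) (c : ℕ → ℂ) (g : ℕ → ℝ) :
    ∫ t, w t * ‖∑ m ∈ s, c m * e (t * g m)‖ ^ 2 ≤
      3 * ∑ j ∈ s.image (fun m => ⌊g m⌋),
        ∫ t, w t * ‖∑ m ∈ s.filter (fun m => ⌊g m⌋ = j), c m * e (t * g m)‖ ^ 2 := by
  set J := s.image (fun m => ⌊g m⌋) with hJ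
  set P : ℤ → ℝ → ℂ := fun j t => ∑ m ∈ s.filter (fun m => ⌊g m⌋ = j), c m * e (t * g m) with hP
  set A : ℤ → ℝ := fun j => ∫ t, w t * ‖P j t‖ ^ 2 with hA
  have hA0 : ∀ j, 0 ≤ A j := fun j => integral_nonneg fun t => mul_nonneg (hwn t) (by positivity)
  have hAi : ∀ j, Integrable (fun t => w t * ‖P j t‖ ^ 2) := fun j => integrable_w_sq w hwi _ c g
  have cP : ∀ j, Continuous (P j) := fun j => poly_cont _ c g
  have hbi : ∀ j k, Integrable (fun t => w t * inner ℝ (P j t) (P k t)) := by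
    intro j k
    refine integrable_w_mul w hwi _ ((cP j).inner (cP k))
      ((∑ m ∈ s.filter (fun m => ⌊g m⌋ = j), ‖c m‖) *
        (∑ m ∈ s.filter (fun m => ⌊g m⌋ = k), ‖c m‖)) ?_
    intro t
    refine (abs_real_inner_le_norm _ _).trans ?_
    have h1 := poly_bound (s.filter (fun m => ⌊g m⌋ = j)) c g t
    have h2 := poly_bound (s.filter (fun m => ⌊g m⌋ = k)) c g t
    gcongr
  have e1 : ∀ t, w t * ‖∑ m ∈ s, c m * e (t * g m)‖ ^ 2 =
      ∑ j ∈ J, ∑ k ∈ J, w t * inner ℝ (P j t) (P k t) := by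
    intro t
    have : ∑ m ∈ s, c m * e (t * g m) = ∑ j ∈ J, P j t :=
      (Finset.sum_fiberwise_of_maps_to (fun m hm => Finset.mem_image_of_mem _ hm) _).symm
    rw [this, ← real_inner_self_eq_norm_sq, sum_inner, Finset.mul_sum]
    refine Finset.sum_congr rfl fun j _ => ?_
    rw [inner_sum, Finset.mul_sum]
  simp_rw [e1]
  rw [integral_finsetSum _ fun n _ => integrable_finsetSum _ fun m _ => hbi _ _]
  have e2 : ∀ j k, ∫ t, w t * inner ℝ (P j t) (P k t) ≤
      (if |j - k| ≤ 1 then A j / 2 else 0) + (if |k - j| ≤ 1 then A k / 2 else 0) := by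
    intro j k
    rw [abs_sub_comm k j]
    split_ifs with h
    · have : A j / 2 + A k / 2 = ∫ t, (w t * ‖P j t‖ ^ 2 / 2 + w t * ‖P k t‖ ^ 2 / 2) := by
        rw [integral_add ((hAi j).div_const 2) ((hAi k).div_const 2), integral_div, integral_div]
      rw [this]
      refine integral_mono (hbi j k) (((hAi j).div_const 2).add ((hAi k).div_const 2)) fun t => ?_
      have h1 := real_inner_le_norm (P j t) (P k t)
      have h2 : inner ℝ (P j t) (P k t) ≤ (‖P j t‖ ^ 2 + ‖P k t‖ ^ 2) / 2 := by
        nlinarith [sq_nonneg (‖P j t‖ - ‖P k t‖)]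
      have := mul_le_mul_of_nonneg_left h2 (hwn t)
      show w t * inner ℝ (P j t) (P k t) ≤ w t * ‖P j t‖ ^ 2 / 2 + w t * ‖P k t‖ ^ 2 / 2
      linarith
    · rw [add_zero]
      refine le_of_eq (orth w hwi hw0 _ _ c g ?_)
      intro m hm n hn
      simp only [Finset.mem_filter] at hm hn
      have a1 := Int.floor_le (g m)
      have a2 := Int.lt_floor_add_one (g m)
      have b1 := Int.floor_le (g n)
      have b2 := Int.lt_floor_add_one (g n)
      rw [hm.2] at a1 a2
      rw [hn.2] at b1 b2
      rw [not_le, lt_abs] at h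
      rcases h with h | h
      · have h : (k:ℝ) + 2 ≤ j := by exact_mod_cast (by omega : k + 2 ≤ j)
        rw [le_abs]; right; linarith
      · have h : (j:ℝ) + 2 ≤ k := by exact_mod_cast (by omega : j + 2 ≤ k)
        rw [le_abs]; left; linarith
  calc _ ≤ ∑ j ∈ J, ∑ k ∈ J, ((if |j - k| ≤ 1 then A j / 2 else 0) +
        (if |k - j| ≤ 1 then A k / 2 else 0)) := by
        refine Finset.sum_le_sum fun j _ => ?_
        rw [integral_finsetSum _ fun m _ => hbi _ _]
        exact Finset.sum_le_sum fun k _ => e2 j k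
    _ = 2 * ∑ j ∈ J, ∑ k ∈ J, (if |j - k| ≤ 1 then A j / 2 else 0) := by
        simp_rw [Finset.sum_add_distrib]
        rw [Finset.sum_comm (f := fun j k => if |k - j| ≤ 1 then A k / 2 else 0)]
        ring
    _ ≤ 2 * ∑ j ∈ J, 3 * (A j / 2) := by
        gcongr with j _
        rw [← Finset.sum_filter, Finset.sum_const, nsmul_eq_mul]
        have : (J.filter (fun k => |j - k| ≤ 1)).card ≤ 3 := by
          calc _ ≤ (Finset.Icc (j - 1) (j + 1)).card := by
                apply Finset.card_le_card
                intro k hk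
                simp only [Finset.mem_filter, abs_le] at hk
                rw [Finset.mem_Icc]; omega
            _ = 3 := by rw [Int.card_Icc]; omega
        have h3 : ((J.filter (fun k => |j - k| ≤ 1)).card : ℝ) ≤ 3 := by exact_mod_cast this
        have := hA0 j
        gcongr
    _ = _ := by
        rw [← Finset.mul_sum, ← Finset.sum_div]; ring

open MeasureTheory in
lemma core (w : ℝ → ℝ) (η : ℝ) (hη : 0 < η) (hwi : Integrable w) (hwn : ∀ t, 0 ≤ w t)
    (hw1 : ∀ t ∈ Set.Icc (-η) η, 1 ≤ w t)
    (hw0 : ∀ u : ℝ, 1 ≤ |u| → ∫ t, (w t : ℂ) * e (t * u) = 0)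
    (s : Finset ℕ) (a : ℕ → ℂ) (g : ℕ → ℝ) (Y : ℝ) (hY : 0 ≤ Y)
    (hg : ∀ m ∈ s, ∀ n ∈ s, |(m : ℝ) - n| ≤ Y * |g m - g n|) (B : ℕ) :
    ∫ t in (-η)..η, ∑ b ∈ Finset.Icc 1 B,
        ∑ x ∈ (Finset.range b).filter (fun x => Nat.Coprime x b),
          ‖∑ m ∈ s, a m * e ((x * m : ℕ) / (b : ℝ)) * e (t * g m)‖ ^ 2
      ≤ 3 * (∫ t, w t) * ((B : ℝ) ^ 2 + (1 + 4 * Real.pi ^ 2) * (Y + 1)) *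
          ∑ m ∈ s, ‖a m‖ ^ 2 := by
  set c : (Σ _ : ℕ, ℕ) → ℕ → ℂ := fun r m => a m * e ((r.2 * m : ℕ) / (r.1 : ℝ)) with hc
  set R := (Finset.Icc 1 B).sigma
    (fun b => (Finset.range b).filter (fun x => Nat.Coprime x b)) with hR
  set J := s.image (fun m => ⌊g m⌋) with hJ
  have e0 : ∀ t, (∑ b ∈ Finset.Icc 1 B,
        ∑ x ∈ (Finset.range b).filter (fun x => Nat.Coprime x b),
          ‖∑ m ∈ s, a m * e ((x * m : ℕ) / (b : ℝ)) * e (t * g m)‖ ^ 2) =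
      ∑ r ∈ R, ‖∑ m ∈ s, c r m * e (t * g m)‖ ^ 2 := by
    intro t; rw [Finset.sum_sigma']
  simp_rw [e0]
  have hi : ∀ (s : Finset ℕ) r, Integrable (fun t => w t * ‖∑ m ∈ s, c r m * e (t * g m)‖ ^ 2) :=
    fun s r => integrable_w_sq w hwi s _ g
  have hcont : Continuous (fun t => ∑ r ∈ R, ‖∑ m ∈ s, c r m * e (t * g m)‖ ^ 2) :=
    continuous_finsetSum _ fun r _ => (poly_cont s (c r) g).norm.pow 2
  have hI : Integrable (fun t => w t * ∑ r ∈ R, ‖∑ m ∈ s, c r m * e (t * g m)‖ ^ 2) := by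
    simp_rw [Finset.mul_sum]
    exact integrable_finsetSum _ fun r _ => hi s r
  calc _ ≤ ∫ t in (-η)..η, w t * ∑ r ∈ R, ‖∑ m ∈ s, c r m * e (t * g m)‖ ^ 2 := by
        refine intervalIntegral.integral_mono_on (by linarith) (hcont.intervalIntegrable _ _)
          hI.intervalIntegrable fun t ht => ?_
        exact le_mul_of_one_le_left (Finset.sum_nonneg fun _ _ => by positivity) (hw1 t ht)
    _ ≤ ∫ t, w t * ∑ r ∈ R, ‖∑ m ∈ s, c r m * e (t * g m)‖ ^ 2 := by
        rw [intervalIntegral.integral_of_le (by linarith)]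
        exact setIntegral_le_integral hI (Filter.Eventually.of_forall fun t =>
          mul_nonneg (hwn t) (Finset.sum_nonneg fun _ _ => by positivity))
    _ = ∑ r ∈ R, ∫ t, w t * ‖∑ m ∈ s, c r m * e (t * g m)‖ ^ 2 := by
        simp_rw [Finset.mul_sum]
        exact integral_finsetSum _ fun r _ => hi s r
    _ ≤ ∑ r ∈ R, 3 * ∑ j ∈ J,
        ∫ t, w t * ‖∑ m ∈ s.filter (fun m => ⌊g m⌋ = j), c r m * e (t * g m)‖ ^ 2 :=
        Finset.sum_le_sum fun r _ => block w hwi hwn hw0 s (c r) g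
    _ = 3 * ∑ j ∈ J, ∫ t, w t *
          ∑ r ∈ R, ‖∑ m ∈ s.filter (fun m => ⌊g m⌋ = j), c r m * e (t * g m)‖ ^ 2 := by
        rw [← Finset.mul_sum, Finset.sum_comm]
        congr 1
        refine Finset.sum_congr rfl fun j _ => ?_
        simp_rw [Finset.mul_sum]
        exact (integral_finsetSum _ fun r _ => hi _ r).symm
    _ ≤ 3 * ∑ j ∈ J, ∫ t, w t * (((B : ℝ) ^ 2 + (1 + 4 * Real.pi ^ 2) * (Y + 1)) *
          ∑ m ∈ s.filter (fun m => ⌊g m⌋ = j), ‖a m‖ ^ 2) := by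
        refine mul_le_mul_of_nonneg_left (Finset.sum_le_sum fun j hj => ?_) (by norm_num)
        refine integral_mono ?_ (hwi.mul_const _) fun t => ?_
        · simp_rw [Finset.mul_sum]
          exact integrable_finsetSum _ fun r _ => hi _ r
        refine mul_le_mul_of_nonneg_left ?_ (hwn t)
        obtain ⟨K, hK, hKj⟩ := Finset.mem_image.1 hj
        have := large_sieve (s.filter (fun m => ⌊g m⌋ = j)) (fun m => a m * e (t * g m)) K B
          (Y + 1) (by linarith) (by
            intro m hm
            rw [Finset.mem_filter] at hm
            refine (hg m hm.1 K hK).trans ?_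
            have : |g m - g K| ≤ 1 := (Int.abs_sub_lt_one_of_floor_eq_floor
              (hm.2.trans hKj.symm)).le
            nlinarith)
        rw [Finset.sum_sigma'] at this
        simp only [norm_mul, e_norm, mul_one] at this
        refine le_trans (le_of_eq ?_) this
        refine Finset.sum_congr rfl fun r _ => ?_
        congr 2
        refine Finset.sum_congr rfl fun m _ => ?_
        simp only [hc]; ring
    _ = _ := by
        simp_rw [integral_mul_const]
        rw [← Finset.mul_sum, ← Finset.mul_sum,
          Finset.sum_fiberwise_of_maps_to (fun m hm => Finset.mem_image_of_mem _ hm)]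
        ring

/-- A large sieve inequality with a general oscillatory phase, extending Gallagher's method:
for `f` continuously differentiable with nonvanishing derivative on `[N, N+M]` and
`X` an upper bound for `1/|f'|` there, the mean value of the Farey-twisted exponential sums
integrated over `t ∈ [-T, T]` is `≪ (B²T + X) ∑ |b_m|²` with an absolute implied constant. -/
theorem large_sieve_oscillatory :
    ∃ C : ℝ, 0 < C ∧ ∀ (N M B : ℕ) (T : ℝ) (f f' : ℝ → ℝ) (bm : ℕ → ℂ) (X : ℝ),
      0 < T →
      (∀ y ∈ Set.Icc (N : ℝ) (N + M), HasDerivAt f (f' y) y) →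
      ContinuousOn f' (Set.Icc (N : ℝ) (N + M)) →
      (∀ y ∈ Set.Icc (N : ℝ) (N + M), f' y ≠ 0) →
      (∀ y ∈ Set.Icc (N : ℝ) (N + M), 1 / |f' y| ≤ X) →
      (∫ t in (-T)..T, ∑ b ∈ Finset.Icc 1 B,
          ∑ x ∈ (Finset.range b).filter (fun x => Nat.Coprime x b),
            ‖∑ m ∈ Finset.Ico N (N + M),
                bm m * e ((x * m : ℕ) / (b : ℝ)) * e (t * f m)‖ ^ 2)
        ≤ C * ((B : ℝ) ^ 2 * T + X) * ∑ m ∈ Finset.Ico N (N + M), ‖bm m‖ ^ 2 := by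
  obtain ⟨w, η, hη, -, hwi, hwn, hw1, hw0⟩ := exists_weight
  set W := ∫ t, w t with hW
  have hW0 : 0 ≤ W := MeasureTheory.integral_nonneg hwn
  set C0 : ℝ := 1 + 4 * Real.pi ^ 2 with hC0
  have hC0p : 0 ≤ C0 := by positivity
  refine ⟨3 * W * (1 + C0) * (1 / η + 1) + 1, by positivity, ?_⟩
  intro N M B T f f' bm X hT hf _ hne hX
  rcases Nat.eq_zero_or_pos M with rfl | hM
  · simp
  have hXp : 0 < X := by
    have hN : (N : ℝ) ∈ Set.Icc (N : ℝ) (N + M) := ⟨le_rfl, by simp⟩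
    exact lt_of_lt_of_le (one_div_pos.2 (abs_pos.2 (hne _ hN))) (hX _ hN)
  set S := ∑ m ∈ Finset.Ico N (N + M), ‖bm m‖ ^ 2 with hS
  have hS0 : 0 ≤ S := Finset.sum_nonneg fun _ _ => by positivity
  rcases Nat.eq_zero_or_pos B with rfl | hB
  · simp; positivity
  have hB1 : (1:ℝ) ≤ B := by exact_mod_cast hB
  set κ := T / η with hκ
  have hκ0 : 0 < κ := by positivity
  -- mean value theorem
  have lower : ∀ m ∈ Finset.Ico N (N + M), ∀ n ∈ Finset.Ico N (N + M), m < n →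
      |(m : ℝ) - n| ≤ X * |f m - f n| := by
    intro m hm n hn hmn
    rw [Finset.mem_Ico] at hm hn
    have hmn' : (m : ℝ) < n := by exact_mod_cast hmn
    have hm1 : (N : ℝ) ≤ m := by exact_mod_cast hm.1
    have hn1 : (n : ℝ) ≤ N + M := by exact_mod_cast hn.2.le
    obtain ⟨y, hy, he⟩ := exists_hasDerivAt_eq_slope f f' hmn'
      (fun y hy => (hf y ⟨hm1.trans hy.1, hy.2.trans hn1⟩).continuousAt.continuousWithinAt)
      (fun y hy => hf y ⟨hm1.trans hy.1.le, hy.2.le.trans hn1⟩)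
    have hyI : y ∈ Set.Icc (N : ℝ) (N + M) := ⟨hm1.trans hy.1.le, hy.2.le.trans hn1⟩
    have h1 := hX y hyI
    have h2 := abs_pos.2 (hne y hyI)
    rw [div_le_iff₀ h2] at h1
    have h3 : f n - f m = f' y * (n - m) := by
      rw [he]; field_simp [(sub_pos.2 hmn').ne']
    rw [abs_sub_comm (f m), h3, abs_mul, abs_sub_comm (m : ℝ)]
    nlinarith [abs_nonneg ((n : ℝ) - m)]
  have lower2 : ∀ m ∈ Finset.Ico N (N + M), ∀ n ∈ Finset.Ico N (N + M),
      |(m : ℝ) - n| ≤ X / κ * |κ * f m - κ * f n| := by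
    intro m hm n hn
    have e1 : X / κ * |κ * f m - κ * f n| = X * |f m - f n| := by
      rw [← mul_sub, abs_mul, abs_of_pos hκ0]; field_simp
    rw [e1]
    rcases lt_trichotomy m n with h | h | h
    · exact lower m hm n hn h
    · subst h; simp
    · rw [abs_sub_comm, abs_sub_comm (f m)]; exact lower n hn m hm h
  have hcore := core w η hη hwi hwn hw1 hw0 (Finset.Ico N (N + M)) bm (fun m => κ * f m)
    (X / κ) (by positivity) lower2 B
  rw [← hW, ← hS, ← hC0] at hcore
  have hsub := intervalIntegral.mul_integral_comp_mul_left (a := -η) (b := η) (c := κ)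
    (f := fun t => ∑ b ∈ Finset.Icc 1 B,
          ∑ x ∈ (Finset.range b).filter (fun x => Nat.Coprime x b),
            ‖∑ m ∈ Finset.Ico N (N + M),
                bm m * e ((x * m : ℕ) / (b : ℝ)) * e (t * f m)‖ ^ 2)
  have hκη : κ * η = T := by rw [hκ]; field_simp
  rw [mul_neg, hκη] at hsub
  rw [← hsub]
  have hr : ∀ (t : ℝ) (m : ℕ), κ * t * f m = t * (κ * f m) := fun t m => by ring
  simp_rw [hr]
  calc _ ≤ κ * (3 * W * ((B : ℝ) ^ 2 + C0 * (X / κ + 1)) * S) :=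
        mul_le_mul_of_nonneg_left hcore hκ0.le
    _ ≤ κ * (3 * W * ((1 + C0) * ((B : ℝ) ^ 2 + X / κ)) * S) := by
        have : 0 ≤ X / κ := by positivity
        gcongr
        nlinarith [mul_nonneg hC0p (by nlinarith : (0:ℝ) ≤ (B : ℝ) ^ 2 - 1)]
    _ = 3 * W * (1 + C0) * (1 / η * ((B : ℝ) ^ 2 * T) + X) * S := by
        rw [hκ]; field_simp
    _ ≤ 3 * W * (1 + C0) * ((1 / η + 1) * ((B : ℝ) ^ 2 * T + X)) * S := by
        gcongr
        have h1 : 0 ≤ (B : ℝ) ^ 2 * T := by positivity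
        have h2 : 0 ≤ 1 / η * X := by positivity
        nlinarith
    _ ≤ _ := by
        have : 0 ≤ ((B : ℝ) ^ 2 * T + X) * S := by positivity
        nlinarith
end

section
/- The classical additive large sieve inequality: for complex numbers a_m, Σ_{b ≤ B} Σ_{x mod b, (x,b)=1} |Σ_{N ≤ m < N+M} a_m e(xm/b)|² ≤ (B² + M) Σ_{N ≤ m < N+M} |a_m|². -/
open Finset

theorem ls_trig_aux (y : ℝ) (h0 : 0 ≤ y) (h1 : y ≤ Real.pi / 2) :
    y ^ 2 * (1 + 2 * Real.cos y) ≤ 3 * Real.sin y ^ 2 := by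
  obtain ⟨z, rfl⟩ : ∃ z, y = 2 * z := ⟨y / 2, by ring⟩
  have hz0 : 0 ≤ z := by linarith
  have hz1 : z ≤ 0.79 := by have := Real.pi_lt_d2; linarith
  have hs := Real.sin_ge_sub_cube hz0
  have hs1 := Real.sin_le hz0
  have hcs := Real.sin_sq_add_cos_sq z
  rw [Real.sin_two_mul, Real.cos_two_mul]
  set s := Real.sin z
  set c := Real.cos z
  have hc : c ^ 2 = 1 - s ^ 2 := by linarith
  have hq : z ^ 2 ≤ 0.6241 := by nlinarith
  have hlow : 0 ≤ z - z ^ 3 / 6 := by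
    have : z - z ^ 3 / 6 = z * (1 - z ^ 2 / 6) := by ring
    rw [this]; apply mul_nonneg hz0; linarith
  have hw : (z - z ^ 3 / 6) ^ 2 ≤ s ^ 2 := by gcongr
  have hw2 : s ^ 2 ≤ z ^ 2 := by
    have : 0 ≤ s := hlow.trans hs
    gcongr
  obtain ⟨q, hqd⟩ : ∃ q, q = z ^ 2 := ⟨_, rfl⟩
  obtain ⟨w, hwd⟩ : ∃ w, w = s ^ 2 := ⟨_, rfl⟩
  obtain ⟨p, hpd⟩ : ∃ p, p = q * (1 - q / 6) ^ 2 := ⟨_, rfl⟩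
  have hp' : (z - z ^ 3 / 6) ^ 2 = p := by rw [hpd, hqd]; ring
  have hq0 : 0 ≤ q := by rw [hqd]; positivity
  rw [hp', ← hwd] at hw
  rw [← hwd, ← hqd] at hw2
  rw [← hqd] at hq
  have key : 0 ≤ 3 * w - 3 * w ^ 2 + 4 * q * w - 3 * q := by
    have h1 : 0 ≤ 3 * p - 3 * p ^ 2 + 4 * q * p - 3 * q := by
      have : 3 * p - 3 * p ^ 2 + 4 * q * p - 3 * q
        = q ^ 3 * (3 / 4 - 7 / 18 * q + q ^ 2 / 18 - q ^ 3 / 432) := by rw [hpd]; ring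
      rw [this]
      apply mul_nonneg (by positivity)
      have : q ^ 3 ≤ q ^ 2 := by nlinarith [sq_nonneg q]
      nlinarith [sq_nonneg q]
    have h2 : 0 ≤ (w - p) * (3 - 3 * (w + p) + 4 * q) := by
      apply mul_nonneg (by linarith); linarith
    nlinarith
  calc _ = 4 * (q * (3 - 4 * w)) := by rw [hc, ← hwd, hqd]; ring
    _ ≤ 12 * (w * (1 - w)) := by nlinarith
    _ = _ := by rw [mul_pow, mul_pow, hc, ← hwd]; ring

theorem ls_trig (t : ℝ) (ht : t - round t ≠ 0) :
    (1 / Real.sin (Real.pi * t)) ^ 2 +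
      2 * |1 / Real.sin (Real.pi * t) * (Real.cos (Real.pi * t) / Real.sin (Real.pi * t))|
    ≤ 3 / Real.pi ^ 2 * (1 / (t - round t) ^ 2) := by
  have hpi := Real.pi_pos
  set d := t - round t with hd
  have habs : |d| ≤ 1 / 2 := abs_sub_round t
  have heq : Real.pi * t = Real.pi * d + (round t : ℤ) * Real.pi := by rw [hd]; ring
  have hsin : |Real.sin (Real.pi * t)| = Real.sin (Real.pi * |d|) := by
    rw [heq, Real.sin_add_int_mul_pi, abs_mul, abs_zpow, abs_neg, abs_one, one_zpow, one_mul]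
    have h0 : 0 ≤ Real.sin (Real.pi * |d|) := by
      apply Real.sin_nonneg_of_nonneg_of_le_pi (by positivity)
      nlinarith
    rcases abs_choice d with h | h
    · rw [h] at h0 ⊢; exact abs_of_nonneg h0
    · rw [h] at h0 ⊢
      rw [mul_neg, Real.sin_neg] at h0 ⊢
      exact abs_of_nonpos (by linarith)
  have hcos : |Real.cos (Real.pi * t)| = Real.cos (Real.pi * |d|) := by
    rw [heq, Real.cos_add_int_mul_pi, abs_mul, abs_zpow, abs_neg, abs_one, one_zpow, one_mul]
    have h0 : 0 ≤ Real.cos (Real.pi * |d|) := by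
      apply Real.cos_nonneg_of_mem_Icc
      constructor
      · have : 0 ≤ Real.pi * |d| := by positivity
        linarith
      · nlinarith
    rcases abs_choice d with h | h
    · rw [h] at h0 ⊢; exact abs_of_nonneg h0
    · rw [h] at h0 ⊢
      rw [mul_neg, Real.cos_neg] at h0 ⊢
      exact abs_of_nonneg h0
  have hdpos : 0 < |d| := abs_pos.mpr ht
  have hspos : 0 < Real.sin (Real.pi * |d|) :=
    Real.sin_pos_of_pos_of_lt_pi (by positivity) (by nlinarith)
  have haux := ls_trig_aux (Real.pi * |d|) (by positivity) (by nlinarith)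
  rw [abs_mul, abs_div, abs_div, hsin, hcos, abs_one, div_pow, ← sq_abs (Real.sin (Real.pi * t)),
    hsin, ← sq_abs d]
  rw [show 3 / Real.pi ^ 2 * (1 / |d| ^ 2) = 3 / (Real.pi * |d|) ^ 2 by field_simp]
  have : (1:ℝ) ^ 2 / Real.sin (Real.pi * |d|) ^ 2 + 2 * (1 / Real.sin (Real.pi * |d|) *
      (Real.cos (Real.pi * |d|) / Real.sin (Real.pi * |d|)))
      = (1 + 2 * Real.cos (Real.pi * |d|)) / Real.sin (Real.pi * |d|) ^ 2 := by
    field_simp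
  rw [this, div_le_div_iff₀ (by positivity) (by positivity)]
  linarith

theorem ls_space_pos {ι : Type*} (S : Finset ι) (y : ι → ℝ) (δ : ℝ) (hδ : 0 < δ)
    (h0 : ∀ i ∈ S, δ ≤ y i) (hsep : ∀ i ∈ S, ∀ j ∈ S, i ≠ j → δ ≤ |y i - y j|) :
    ∑ i ∈ S, 1 / (y i) ^ 2 ≤ (Real.pi ^ 2 / 6) / δ ^ 2 := by
  have hnn : ∀ i ∈ S, 1 ≤ y i / δ := fun i hi => by
    rw [le_div_iff₀ hδ]; linarith [h0 i hi]
  have hfl : ∀ i ∈ S, ((⌊y i / δ⌋₊ : ℕ) : ℝ) * δ ≤ y i ∧ y i < ((⌊y i / δ⌋₊ : ℕ) : ℝ) * δ + δ := by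
    intro i hi
    have a1 := Nat.floor_le (zero_le_one.trans (hnn i hi))
    have a2 := Nat.lt_floor_add_one (y i / δ)
    rw [le_div_iff₀ hδ] at a1
    rw [div_lt_iff₀ hδ] at a2
    exact ⟨a1, by linarith⟩
  have hinj : Set.InjOn (fun i => ⌊y i / δ⌋₊) (S : Set ι) := by
    intro i hi j hj hij
    by_contra hne
    have h := hsep i hi j hj hne
    simp only at hij
    have h1 := hfl i hi
    have h2 := hfl j hj
    rw [hij] at h1
    have : |y i - y j| < δ := by rw [abs_lt]; constructor <;> linarith [h1.1, h1.2, h2.1, h2.2]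
    linarith
  calc ∑ i ∈ S, 1 / (y i) ^ 2 ≤ ∑ i ∈ S, (1 / ((⌊y i / δ⌋₊ : ℕ) : ℝ) ^ 2) / δ ^ 2 := by
        apply Finset.sum_le_sum
        intro i hi
        have hp : 0 < ⌊y i / δ⌋₊ := Nat.floor_pos.mpr (hnn i hi)
        have hp' : (0 : ℝ) < (⌊y i / δ⌋₊ : ℕ) := by exact_mod_cast hp
        rw [div_div, ← mul_pow]
        have := (hfl i hi).1
        gcongr
    _ = (∑ n ∈ S.image (fun i => ⌊y i / δ⌋₊), 1 / (n : ℝ) ^ 2) / δ ^ 2 := by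
        rw [Finset.sum_image hinj, Finset.sum_div]
    _ ≤ _ := by
        gcongr
        exact sum_le_hasSum _ (fun n _ => by positivity) hasSum_zeta_two

theorem ls_space {ι : Type*} (S : Finset ι) (y : ι → ℝ) (δ : ℝ) (hδ : 0 < δ)
    (h0 : ∀ i ∈ S, δ ≤ |y i|) (hsep : ∀ i ∈ S, ∀ j ∈ S, i ≠ j → δ ≤ |y i - y j|) :
    ∑ i ∈ S, 1 / (y i) ^ 2 ≤ (Real.pi ^ 2 / 3) / δ ^ 2 := by
  classical
  rw [← Finset.sum_filter_add_sum_filter_not S (fun i => 0 ≤ y i)]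
  have h1 := ls_space_pos (S.filter (fun i => 0 ≤ y i)) y δ hδ
    (by
      intro i hi
      rw [Finset.mem_filter] at hi
      have := h0 i hi.1
      rwa [abs_of_nonneg hi.2] at this)
    (fun i hi j hj hij => hsep i (Finset.mem_filter.mp hi).1 j (Finset.mem_filter.mp hj).1 hij)
  have h2 := ls_space_pos (S.filter (fun i => ¬ 0 ≤ y i)) (fun i => - y i) δ hδ
    (by
      intro i hi
      rw [Finset.mem_filter] at hi
      have := h0 i hi.1
      rwa [abs_of_neg (not_le.mp hi.2)] at this)
    (fun i hi j hj hij => by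
      have := hsep i (Finset.mem_filter.mp hi).1 j (Finset.mem_filter.mp hj).1 hij
      rw [← abs_neg] at this
      convert this using 2
      ring)
  simp only [neg_sq] at h2
  calc _ ≤ _ := add_le_add h1 h2
    _ = _ := by ring

/-- The eigenvalue bound behind the Montgomery-Vaughan form of Hilbert's inequality. -/
theorem ls_eig {ι : Type*} [Fintype ι] [DecidableEq ι] (c k : ι → ι → ℝ)
    (hc : ∀ r s, c s r = - c r s) (hk : ∀ r s, k s r = - k r s)
    (hid : ∀ r s t, r ≠ s → t ≠ s → r ≠ t → c r s * c t s = c r t * (k t s - k r s))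
    (K : ℝ) (hK : ∀ r, ∑ t, ((c r t) ^ 2 + 2 * |c r t * k r t|) ≤ K)
    (v : ι → ℂ) (μ : ℝ) (hv : ∀ r, ∑ s, (c r s : ℂ) * v s = - Complex.I * μ * v r) :
    μ ^ 2 * ∑ r, ‖v r‖ ^ 2 ≤ K * ∑ r, ‖v r‖ ^ 2 := by
  have hc0 : ∀ r, c r r = 0 := fun r => by have := hc r r; linarith
  have hk0 : ∀ r, k r r = 0 := fun r => by have := hk r r; linarith
  have hpt : ∀ r t s, c r s * c t s = c r t * (k t s - k r s)
      + (if s = t then c r t * k r t else 0) + (if s = r then c r t * k r t else 0)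
      + (if r = t then c r s ^ 2 else 0) := by
    intro r t s
    by_cases h1 : r = t
    · subst h1; simp [hc0]; ring
    · by_cases h2 : s = t
      · subst h2; simp [hc0, hk0, h1, Ne.symm h1]
      · by_cases h3 : s = r
        · subst h3; simp [hc0, hk0, h1, hk s t]
        · simp [h1, h2, h3, hid r s t (Ne.symm h3) (Ne.symm h2) h1]
  set G : ι → ℝ := fun t => ∑ s, k t s with hG
  have hP : ∀ r t, ∑ s, c r s * c t s = c r t * (G t - G r) + 2 * (c r t * k r t)
      + (if r = t then ∑ s, c r s ^ 2 else 0) := by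
    intro r t
    simp_rw [hpt r t]
    rw [Finset.sum_add_distrib, Finset.sum_add_distrib, Finset.sum_add_distrib, ← Finset.mul_sum,
      Finset.sum_sub_distrib]
    by_cases h : r = t
    · subst h; simp [hc0]
    · simp [h, hG]; ring
  -- the sum of squares
  have hsq : ((μ ^ 2 * ∑ r, ‖v r‖ ^ 2 : ℝ) : ℂ)
      = ∑ r, ∑ t, v r * star (v t) * ((∑ s, c r s * c t s : ℝ) : ℂ) := by
    have h1 : ((μ ^ 2 * ∑ r, ‖v r‖ ^ 2 : ℝ) : ℂ)
        = ∑ s, (∑ r, (c s r : ℂ) * v r) * star (∑ t, (c s t : ℂ) * v t) := by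
      push_cast
      rw [Finset.mul_sum]
      refine Finset.sum_congr rfl fun s _ => ?_
      rw [hv s, ← Complex.mul_conj']
      simp only [Complex.star_def, map_mul, map_neg, Complex.conj_I, Complex.conj_ofReal]
      linear_combination ((μ:ℂ) ^ 2 * v s * (starRingEnd ℂ) (v s)) * Complex.I_sq
    rw [h1]
    simp only [star_sum, Finset.sum_mul_sum]
    rw [Finset.sum_comm]
    refine Finset.sum_congr rfl fun r _ => ?_
    rw [Finset.sum_comm]
    refine Finset.sum_congr rfl fun t _ => ?_
    push_cast
    rw [Finset.mul_sum]
    refine Finset.sum_congr rfl fun s _ => ?_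
    rw [hc r s, hc t s]
    simp only [Complex.star_def, map_mul, Complex.conj_ofReal]
    push_cast
    ring
  have hGt : ∑ r, ∑ t, v r * star (v t) * ((c r t * G t : ℝ) : ℂ)
      = ∑ t, Complex.I * μ * G t * (v t * star (v t)) := by
    rw [Finset.sum_comm]
    refine Finset.sum_congr rfl fun t _ => ?_
    have := hv t
    calc _ = - (G t * star (v t) * ∑ r, (c t r : ℂ) * v r) := by
          rw [Finset.mul_sum, ← Finset.sum_neg_distrib]
          refine Finset.sum_congr rfl fun r _ => ?_
          rw [hc t r]; push_cast; ring
      _ = _ := by rw [this]; ring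
  have hGr : ∑ r, ∑ t, v r * star (v t) * ((c r t * G r : ℝ) : ℂ)
      = ∑ t, Complex.I * μ * G t * (v t * star (v t)) := by
    refine Finset.sum_congr rfl fun r _ => ?_
    have := congrArg star (hv r)
    calc _ = (G r * v r * star (∑ t, (c r t : ℂ) * v t)) := by
          rw [star_sum, Finset.mul_sum]
          refine Finset.sum_congr rfl fun t _ => ?_
          simp only [Complex.star_def, map_mul, Complex.conj_ofReal]
          push_cast; ring
      _ = _ := by
          rw [this]
          simp only [Complex.star_def, map_mul, map_neg, Complex.conj_I, Complex.conj_ofReal]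
          ring
  have hexp : ((μ ^ 2 * ∑ r, ‖v r‖ ^ 2 : ℝ) : ℂ)
      = ∑ r, ∑ t, v r * star (v t) * ((2 * (c r t * k r t) : ℝ) : ℂ)
        + ∑ r, ((‖v r‖ ^ 2 * ∑ s, c r s ^ 2 : ℝ) : ℂ) := by
    have h3 : ∀ r, ((‖v r‖ ^ 2 * ∑ s, c r s ^ 2 : ℝ) : ℂ)
        = ∑ t, v r * star (v t) * ((if r = t then ∑ s, c r s ^ 2 else 0 : ℝ) : ℂ) := by
      intro r
      symm
      refine (Finset.sum_eq_single r ?_ ?_).trans ?_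
      rotate_left 2
      · rw [if_pos rfl, Complex.star_def, Complex.mul_conj']; push_cast; rfl
      · intro t _ ht; simp [Ne.symm ht]
      · simp
    rw [hsq]
    simp_rw [hP, h3]
    have h4 : ∀ r t, v r * star (v t) * ((c r t * (G t - G r) + 2 * (c r t * k r t)
      + (if r = t then ∑ s, c r s ^ 2 else 0) : ℝ) : ℂ) =
      v r * star (v t) * ((c r t * G t : ℝ) : ℂ) - v r * star (v t) * ((c r t * G r : ℝ) : ℂ)
      + v r * star (v t) * ((2 * (c r t * k r t) : ℝ) : ℂ)
      + v r * star (v t) * ((if r = t then ∑ s, c r s ^ 2 else 0 : ℝ) : ℂ) := by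
      intro r t
      push_cast; ring
    simp_rw [h4, Finset.sum_add_distrib, Finset.sum_sub_distrib]
    rw [hGt, hGr, sub_self, zero_add]
  have hb1 : ‖∑ r, ∑ t, v r * star (v t) * ((2 * (c r t * k r t) : ℝ) : ℂ)‖
      ≤ ∑ r, ‖v r‖ ^ 2 * ∑ t, 2 * |c r t * k r t| := by
    have hsw : ∑ r, ∑ t, |c r t * k r t| * ‖v t‖ ^ 2 = ∑ r, ∑ t, |c r t * k r t| * ‖v r‖ ^ 2 := by
      rw [Finset.sum_comm]
      refine Finset.sum_congr rfl fun r _ => Finset.sum_congr rfl fun t _ => ?_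
      rw [hc r t, hk r t]; ring_nf
    calc _ ≤ ∑ r, ∑ t, ‖v r * star (v t) * ((2 * (c r t * k r t) : ℝ) : ℂ)‖ :=
          (norm_sum_le _ _).trans (Finset.sum_le_sum fun r _ => norm_sum_le _ _)
      _ ≤ ∑ r, ∑ t, (|c r t * k r t| * ‖v r‖ ^ 2 + |c r t * k r t| * ‖v t‖ ^ 2) := by
          refine Finset.sum_le_sum fun r _ => Finset.sum_le_sum fun t _ => ?_
          rw [norm_mul, norm_mul, norm_star, Complex.norm_real, Real.norm_eq_abs, abs_mul, abs_two]
          nlinarith [mul_nonneg (abs_nonneg (c r t * k r t)) (sq_nonneg (‖v r‖ - ‖v t‖))]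
      _ = _ := by
          simp_rw [Finset.sum_add_distrib]
          rw [hsw, ← Finset.sum_add_distrib]
          refine Finset.sum_congr rfl fun r _ => ?_
          rw [← Finset.sum_add_distrib, Finset.mul_sum]
          refine Finset.sum_congr rfl fun t _ => ?_
          ring
  have hfin : μ ^ 2 * ∑ r, ‖v r‖ ^ 2 ≤ ∑ r, ‖v r‖ ^ 2 * ∑ t, 2 * |c r t * k r t|
      + ∑ r, (‖v r‖ ^ 2 * ∑ s, c r s ^ 2) := by
    have h5 := congrArg Complex.re hexp
    rw [Complex.ofReal_re, Complex.add_re, ← Complex.ofReal_sum, Complex.ofReal_re] at h5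
    rw [h5]
    gcongr
    exact (Complex.re_le_norm _).trans hb1
  refine hfin.trans ?_
  rw [← Finset.sum_add_distrib, Finset.mul_sum]
  refine Finset.sum_le_sum fun r _ => ?_
  have := hK r
  rw [Finset.sum_add_distrib] at this
  rw [← mul_add, mul_comm K]
  gcongr
  linarith

open ComplexOrder in
/-- Hermitian form bound from the eigenvalue bound. -/
theorem ls_form {ι : Type*} [Fintype ι] [DecidableEq ι] (c k : ι → ι → ℝ)
    (hc : ∀ r s, c s r = - c r s) (hk : ∀ r s, k s r = - k r s)
    (hid : ∀ r s t, r ≠ s → t ≠ s → r ≠ t → c r s * c t s = c r t * (k t s - k r s))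
    (K : ℝ) (hK0 : 0 ≤ K) (hK : ∀ r, ∑ t, ((c r t) ^ 2 + 2 * |c r t * k r t|) ≤ K ^ 2)
    (u : ι → ℂ) :
    (∑ r, ∑ s, u r * star (u s) * (Complex.I * c r s)).re ≤ K * ∑ r, ‖u r‖ ^ 2 := by
  let H : Matrix ι ι ℂ := fun r s => (if r = s then (K : ℂ) else 0) + Complex.I * c r s
  have hH : H.IsHermitian := by
    ext r s
    rw [Matrix.conjTranspose_apply]
    simp only [H]
    rw [hc r s]
    by_cases h : r = s
    · subst h
      simp
    · simp [h, Ne.symm h]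
  have hmul : ∀ (w : ι → ℂ) r, (H.mulVec w) r = K * w r + Complex.I * ∑ s, (c r s : ℂ) * w s := by
    intro w r
    simp only [H, Matrix.mulVec, dotProduct, add_mul, Finset.sum_add_distrib, ite_mul, zero_mul,
      Finset.sum_ite_eq, Finset.mem_univ, if_true, Finset.mul_sum, mul_assoc]
  have hpsd : H.PosSemidef := by
    rw [hH.posSemidef_iff_eigenvalues_nonneg]
    intro j
    have hj := hH.mulVec_eigenvectorBasis j
    set v : ι → ℂ := ⇑(hH.eigenvectorBasis j) with hvd
    set h := hH.eigenvalues j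
    have hn : ∑ r, ‖v r‖ ^ 2 = 1 := by
      have := hH.eigenvectorBasis.orthonormal.1 j
      have h2 := EuclideanSpace.norm_sq_eq (hH.eigenvectorBasis j)
      rw [this] at h2
      simpa using h2.symm
    have hb := ls_eig c k hc hk hid (K ^ 2) hK v (h - K) (by
      intro r
      have := congrFun hj r
      rw [hmul] at this
      simp only [Pi.smul_apply, Complex.real_smul] at this
      push_cast
      linear_combination (-Complex.I) * this + (∑ s, (c r s : ℂ) * v s) * Complex.I_sq)
    rw [hn, mul_one, mul_one] at hb
    have := abs_le_of_sq_le_sq' hb hK0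
    show 0 ≤ h
    linarith [this.1]
  have hq := hpsd.dotProduct_mulVec_nonneg u
  have hq' := (Complex.le_def.mp hq).1
  have hval : star u ⬝ᵥ H.mulVec u = ((K * ∑ r, ‖u r‖ ^ 2 : ℝ) : ℂ)
      - ∑ r, ∑ s, u r * star (u s) * (Complex.I * c r s) := by
    rw [Finset.sum_comm (f := fun r s => u r * star (u s) * (Complex.I * c r s))]
    push_cast
    rw [Finset.mul_sum, ← Finset.sum_sub_distrib]
    simp only [dotProduct]
    refine Finset.sum_congr rfl fun r _ => ?_
    rw [hmul, ← Complex.mul_conj', mul_add]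
    simp only [Finset.mul_sum, Pi.star_apply, Complex.star_def]
    rw [sub_eq_add_neg, ← Finset.sum_neg_distrib]
    congr 1
    · ring
    · refine Finset.sum_congr rfl fun s _ => ?_
      rw [hc r s]; push_cast; ring
  rw [hval, Complex.sub_re, Complex.ofReal_re, Complex.zero_re] at hq'
  linarith

theorem ls_sin_ne {θ δ : ℝ} (hδ : 0 < δ) (h : ∀ n : ℤ, δ ≤ |θ - n|) :
    Real.sin (Real.pi * θ) ≠ 0 := by
  intro h0
  obtain ⟨n, hn⟩ := Real.sin_eq_zero_iff.mp h0
  have : θ = n := by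
    have := Real.pi_pos.ne'
    rw [mul_comm] at hn
    exact (mul_left_cancel₀ this hn).symm
  have h1 := h n
  rw [this, sub_self, abs_zero] at h1
  linarith

theorem ls_hilbert {ι : Type*} [Fintype ι] [DecidableEq ι] (x : ι → ℝ) (δ : ℝ) (hδ : 0 < δ)
    (hsep : ∀ r s, r ≠ s → ∀ n : ℤ, δ ≤ |x r - x s - n|) (u : ι → ℂ) :
    |(∑ r, ∑ s, u r * star (u s) *
      (Complex.I * ((1 / Real.sin (Real.pi * (x r - x s)) : ℝ) : ℂ))).re|
      ≤ 1 / δ * ∑ r, ‖u r‖ ^ 2 := by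
  set c : ι → ι → ℝ := fun r s => 1 / Real.sin (Real.pi * (x r - x s)) with hcd
  set k : ι → ι → ℝ := fun r s =>
    Real.cos (Real.pi * (x r - x s)) / Real.sin (Real.pi * (x r - x s)) with hkd
  have hflip : ∀ r s, Real.pi * (x s - x r) = - (Real.pi * (x r - x s)) := fun r s => by ring
  have hc : ∀ r s, c s r = - c r s := by
    intro r s
    simp only [hcd]
    rw [hflip r s, Real.sin_neg, div_neg]
  have hk : ∀ r s, k s r = - k r s := by
    intro r s
    simp only [hkd]
    rw [hflip r s, Real.sin_neg, Real.cos_neg, div_neg]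
  have hid : ∀ r s t, r ≠ s → t ≠ s → r ≠ t → c r s * c t s = c r t * (k t s - k r s) := by
    intro r s t h1 h2 h3
    have n1 := ls_sin_ne hδ (hsep r s h1)
    have n2 := ls_sin_ne hδ (hsep t s h2)
    have n3 := ls_sin_ne hδ (hsep r t h3)
    simp only [hcd, hkd]
    have hs : Real.sin (Real.pi * (x r - x t))
        = Real.sin (Real.pi * (x r - x s)) * Real.cos (Real.pi * (x t - x s))
          - Real.cos (Real.pi * (x r - x s)) * Real.sin (Real.pi * (x t - x s)) := by
      rw [← Real.sin_sub]; congr 1; ring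
    have : 1 / Real.sin (Real.pi * (x r - x s)) * (1 / Real.sin (Real.pi * (x t - x s)))
      = 1 / Real.sin (Real.pi * (x r - x t)) * (Real.sin (Real.pi * (x r - x t)) /
        (Real.sin (Real.pi * (x r - x s)) * Real.sin (Real.pi * (x t - x s)))) := by
      field_simp
    rw [this]
    congr 1
    rw [hs]
    field_simp
  have hK : ∀ r, ∑ t, ((c r t) ^ 2 + 2 * |c r t * k r t|) ≤ (1 / δ) ^ 2 := by
    intro r
    rw [← Finset.add_sum_erase _ _ (Finset.mem_univ r)]
    have h0 : c r r = 0 := by simp [hcd]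
    rw [h0]
    simp only [zero_mul, abs_zero, mul_zero, ne_eq, OfNat.ofNat_ne_zero, not_false_eq_true,
      zero_pow, add_zero, zero_add]
    set d : ι → ℝ := fun t => (x r - x t) - round (x r - x t) with hd
    have hdl : ∀ t ∈ Finset.univ.erase r, δ ≤ |d t| := fun t ht =>
      hsep r t (Finset.ne_of_mem_erase ht).symm _
    calc _ ≤ ∑ t ∈ Finset.univ.erase r, 3 / Real.pi ^ 2 * (1 / (d t) ^ 2) := by
          refine Finset.sum_le_sum fun t ht => ?_
          apply ls_trig
          have := hdl t ht
          intro h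
          simp only [hd] at this
          rw [h, abs_zero] at this
          linarith
      _ ≤ 3 / Real.pi ^ 2 * ((Real.pi ^ 2 / 3) / δ ^ 2) := by
          rw [← Finset.mul_sum]
          gcongr
          apply ls_space _ _ _ hδ hdl
          intro i _ j _ hij
          have := hsep j i (Ne.symm hij) (round (x r - x i) - round (x r - x j))
          convert this using 2
          simp only [hd]; push_cast; ring
      _ = _ := by
          have := Real.pi_pos.ne'
          field_simp
  have hpos : 0 ≤ 1 / δ := by positivity
  have h1 := ls_form c k hc hk hid (1 / δ) hpos hK u
  have h2 := ls_form (fun r s => - c r s) (fun r s => - k r s)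
    (fun r s => by rw [hc r s]) (fun r s => by rw [hk r s])
    (fun r s t a b c' => by have := hid r s t a b c'; linear_combination this)
    (1 / δ) hpos (fun r => by simpa using hK r) u
  rw [abs_le]
  refine ⟨?_, h1⟩
  simp only [Complex.ofReal_neg, mul_neg, Finset.sum_neg_distrib, Complex.neg_re] at h2
  linarith

theorem ls_e_add (a b : ℝ) : e (a + b) = e a * e b := by
  simp only [e]; rw [← Complex.exp_add]; congr 1; push_cast; ring

theorem ls_e_zero : e 0 = 1 := by simp [e]

theorem ls_e_star (a : ℝ) : star (e a) = e (-a) := by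
  simp only [e, Complex.star_def]
  rw [← Complex.exp_conj]
  congr 1
  simp only [map_mul, Complex.conj_ofReal, Complex.conj_I, Complex.conj_ofNat, Complex.ofReal_neg]
  ring

theorem ls_e_norm (a : ℝ) : ‖e a‖ = 1 := by
  simp only [e]
  rw [show 2 * (Real.pi : ℂ) * Complex.I * a = ((2 * Real.pi * a : ℝ) : ℂ) * Complex.I by
    push_cast; ring]
  exact Complex.norm_exp_ofReal_mul_I _

theorem ls_e_diff (θ : ℝ) : e (-(θ / 2)) - e (θ / 2)
    = - (2 * Complex.I * ((Real.sin (Real.pi * θ) : ℝ) : ℂ)) := by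
  simp only [e]
  rw [Complex.ofReal_sin, Complex.sin]
  push_cast
  rw [show 2 * (Real.pi : ℂ) * Complex.I * (-(θ / 2)) = -(Real.pi * θ) * Complex.I by ring,
    show 2 * (Real.pi : ℂ) * Complex.I * (θ / 2) = Real.pi * θ * Complex.I by ring]
  linear_combination (Complex.exp (-(Real.pi * θ) * Complex.I)
    - Complex.exp (Real.pi * θ * Complex.I)) * Complex.I_sq

theorem ls_kernel (N M : ℕ) (θ : ℝ) (h : Real.sin (Real.pi * θ) ≠ 0) :
    ∑ m ∈ Finset.Ico N (N + M), e (m * θ)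
      = (1 / 2) * (Complex.I * ((1 / Real.sin (Real.pi * θ) : ℝ) : ℂ)) *
        (e ((N - 1 / 2) * θ) - e ((N + M - 1 / 2) * θ)) := by
  induction M with
  | zero => simp
  | succ M ih =>
    rw [← add_assoc, Finset.sum_Ico_succ_top (by omega), ih]
    have h1 : e ((N + M - 1 / 2) * θ) = e ((N + M : ℕ) * θ) * e (-(θ / 2)) := by
      rw [← ls_e_add]; congr 1; push_cast; ring
    have h2 : e ((N + (M + 1 : ℕ) - 1 / 2) * θ) = e ((N + M : ℕ) * θ) * e (θ / 2) := by
      rw [← ls_e_add]; congr 1; push_cast; ring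
    rw [h1, h2]
    have hd := ls_e_diff θ
    have hs : ((Real.sin (Real.pi * θ) : ℝ) : ℂ) ≠ 0 := by exact_mod_cast h
    rw [Complex.ofReal_div, Complex.ofReal_one]
    set S : ℂ := ((Real.sin (Real.pi * θ) : ℝ) : ℂ)
    have hS : 1 / S * S = 1 := by field_simp
    set E := e ((N + M : ℕ) * θ)
    linear_combination (-(1 / 2) * (Complex.I * (1 / S)) * E) * hd
      + (E * (1 / S * S)) * Complex.I_sq - E * hS

theorem ls_dual {ι : Type*} [Fintype ι] [DecidableEq ι] (x : ι → ℝ) (δ : ℝ) (hδ : 0 < δ)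
    (hsep : ∀ r s, r ≠ s → ∀ n : ℤ, δ ≤ |x r - x s - n|) (N M : ℕ) (u : ι → ℂ) :
    ∑ m ∈ Finset.Ico N (N + M), ‖∑ r, u r * e (m * x r)‖ ^ 2
      ≤ (M + 1 / δ) * ∑ r, ‖u r‖ ^ 2 := by
  set Q : (ι → ℂ) → ℂ := fun u => ∑ r, ∑ s, u r * star (u s) *
      (Complex.I * ((1 / Real.sin (Real.pi * (x r - x s)) : ℝ) : ℂ)) with hQ
  set w : ℝ → ι → ℂ := fun α r => u r * e (α * x r) with hw
  have hwn : ∀ α, ∑ r, ‖w α r‖ ^ 2 = ∑ r, ‖u r‖ ^ 2 := by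
    intro α; simp [hw, ls_e_norm]
  have hb : ∀ α, |(Q (w α)).re| ≤ 1 / δ * ∑ r, ‖u r‖ ^ 2 := by
    intro α
    rw [← hwn α]
    exact ls_hilbert x δ hδ hsep (w α)
  have hee : ∀ (α : ℝ) r s, w α r * star (w α s) = u r * star (u s) * e (α * (x r - x s)) := by
    intro α r s
    simp only [hw, star_mul']
    rw [ls_e_star, show α * (x r - x s) = α * x r + -(α * x s) by ring, ls_e_add]
    ring
  have hmain : ((∑ m ∈ Finset.Ico N (N + M), ‖∑ r, u r * e (m * x r)‖ ^ 2 : ℝ) : ℂ)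
      = ((M * ∑ r, ‖u r‖ ^ 2 : ℝ) : ℂ)
        + (1 / 2) * (Q (w (N - 1 / 2)) - Q (w (N + M - 1 / 2))) := by
    have h1 : ((∑ m ∈ Finset.Ico N (N + M), ‖∑ r, u r * e (m * x r)‖ ^ 2 : ℝ) : ℂ)
        = ∑ r, ∑ s, u r * star (u s) * ∑ m ∈ Finset.Ico N (N + M), e (m * (x r - x s)) := by
      push_cast
      have : ∀ m : ℕ, ((‖∑ r, u r * e (m * x r)‖ : ℝ) : ℂ) ^ 2
          = ∑ r, ∑ s, u r * star (u s) * e (m * (x r - x s)) := by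
        intro m
        rw [← Complex.mul_conj', ← Complex.star_def, star_sum, Finset.sum_mul_sum]
        refine Finset.sum_congr rfl fun r _ => Finset.sum_congr rfl fun s _ => ?_
        exact hee m r s
      simp_rw [this]
      rw [Finset.sum_comm]
      refine Finset.sum_congr rfl fun r _ => ?_
      rw [Finset.sum_comm]
      refine Finset.sum_congr rfl fun s _ => ?_
      rw [Finset.mul_sum]
    have h2 : ((M * ∑ r, ‖u r‖ ^ 2 : ℝ) : ℂ)
        = ∑ r, ∑ s, u r * star (u s) * (if r = s then (M : ℂ) else 0) := by
      push_cast
      rw [Finset.mul_sum]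
      refine Finset.sum_congr rfl fun r _ => ?_
      simp only [mul_ite, mul_zero, Finset.sum_ite_eq, Finset.mem_univ, if_true]
      rw [Complex.star_def, Complex.mul_conj']
      ring
    rw [h1, h2]
    simp only [hQ, hee]
    simp_rw [← Finset.sum_sub_distrib, Finset.mul_sum (s := Finset.univ),
      ← Finset.sum_add_distrib]
    refine Finset.sum_congr rfl fun r _ => Finset.sum_congr rfl fun s _ => ?_
    by_cases h : r = s
    · subst h
      simp [ls_e_zero]
    · rw [ls_kernel N M _ (ls_sin_ne hδ (hsep r s h)), if_neg h]
      ring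
  have h5 := congrArg Complex.re hmain
  rw [Complex.ofReal_re, Complex.add_re, Complex.ofReal_re] at h5
  have h6 : ((1 / 2 : ℂ) * (Q (w (N - 1 / 2)) - Q (w (N + M - 1 / 2)))).re
      = 1 / 2 * ((Q (w (N - 1 / 2))).re - (Q (w (N + M - 1 / 2))).re) := by
    rw [show (1 / 2 : ℂ) = ((1 / 2 : ℝ) : ℂ) by push_cast; rfl, Complex.re_ofReal_mul,
      Complex.sub_re]
  rw [h5, h6, add_mul]
  have a1 := (abs_le.mp (hb (N - 1 / 2))).2
  have a2 := (abs_le.mp (hb (N + M - 1 / 2))).1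
  linarith

theorem ls_general {ι : Type*} [Fintype ι] [DecidableEq ι] (x : ι → ℝ) (δ : ℝ) (hδ : 0 < δ)
    (hsep : ∀ r s, r ≠ s → ∀ n : ℤ, δ ≤ |x r - x s - n|) (N M : ℕ) (a : ℕ → ℂ) :
    ∑ r, ‖∑ m ∈ Finset.Ico N (N + M), a m * e (m * x r)‖ ^ 2
      ≤ (M + 1 / δ) * ∑ m ∈ Finset.Ico N (N + M), ‖a m‖ ^ 2 := by
  set T : ι → ℂ := fun r => ∑ m ∈ Finset.Ico N (N + M), a m * e (m * x r) with hT
  set S := ∑ r, ‖T r‖ ^ 2 with hS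
  set A := ∑ m ∈ Finset.Ico N (N + M), ‖a m‖ ^ 2 with hA
  have hd := ls_dual x δ hδ hsep N M (fun r => star (T r))
  simp only [norm_star] at hd
  have hS0 : 0 ≤ S := by positivity
  have hA0 : 0 ≤ A := by positivity
  have h1 : (S : ℂ) = ∑ m ∈ Finset.Ico N (N + M), a m * ∑ r, star (T r) * e (m * x r) := by
    have : ∀ r, ((‖T r‖ : ℝ) : ℂ) ^ 2
        = ∑ m ∈ Finset.Ico N (N + M), a m * (star (T r) * e (m * x r)) := by
      intro r
      rw [← Complex.mul_conj', ← Complex.star_def]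
      conv_lhs => rw [mul_comm]; arg 2; simp only [hT]
      rw [Finset.mul_sum]
      refine Finset.sum_congr rfl fun m _ => by ring
    rw [hS]
    push_cast
    simp_rw [this, Finset.mul_sum]
    rw [Finset.sum_comm]
  have h2 : S ≤ ∑ m ∈ Finset.Ico N (N + M), ‖a m‖ * ‖∑ r, star (T r) * e (m * x r)‖ := by
    have : S = ‖(S : ℂ)‖ := by rw [Complex.norm_real, Real.norm_eq_abs, abs_of_nonneg hS0]
    rw [this, h1]
    refine (norm_sum_le _ _).trans (Finset.sum_le_sum fun m _ => ?_)
    rw [norm_mul]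
  have h3 : S ^ 2 ≤ A * ((M + 1 / δ) * S) := by
    calc S ^ 2 ≤ (∑ m ∈ Finset.Ico N (N + M), ‖a m‖ * ‖∑ r, star (T r) * e (m * x r)‖) ^ 2 := by
          gcongr
      _ ≤ _ := Finset.sum_mul_sq_le_sq_mul_sq _ _ _
      _ ≤ _ := by gcongr
  rcases hS0.eq_or_lt with h | h
  · rw [← h]; positivity
  · nlinarith

theorem ls_farey (B b b' y y' : ℕ) (hb : 1 ≤ b) (hb' : 1 ≤ b') (hbB : b ≤ B) (hbB' : b' ≤ B)
    (hy : y < b) (hy' : y' < b') (hc : Nat.Coprime y b) (hc' : Nat.Coprime y' b')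
    (hne : ¬ (b = b' ∧ y = y')) (n : ℤ) :
    1 / (B : ℝ) ^ 2 ≤ |(y : ℝ) / b - (y' : ℝ) / b' - n| := by
  have p1 : (0 : ℝ) < b := by exact_mod_cast hb
  have p2 : (0 : ℝ) < b' := by exact_mod_cast hb'
  have hz : (y : ℤ) * b' - y' * b - n * b * b' ≠ 0 := by
    intro h
    apply hne
    have d1 : (b : ℤ) ∣ b' := by
      have : (b : ℤ) ∣ y * b' := ⟨y' + n * b', by linear_combination h⟩
      exact (Nat.isCoprime_iff_coprime.mpr hc).symm.dvd_of_dvd_mul_left this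
    have d2 : (b' : ℤ) ∣ b := by
      have : (b' : ℤ) ∣ y' * b := ⟨y - n * b, by linear_combination -h⟩
      exact (Nat.isCoprime_iff_coprime.mpr hc').symm.dvd_of_dvd_mul_left this
    have hbb : b = b' := Nat.dvd_antisymm (by exact_mod_cast d1) (by exact_mod_cast d2)
    subst hbb
    refine ⟨rfl, ?_⟩
    have hb0 : (b : ℤ) ≠ 0 := by omega
    have h2 : (y : ℤ) - y' = b * n := by
      apply mul_right_cancel₀ hb0
      linear_combination h
    have h3 : (y : ℤ) - y' = 0 := by
      apply Int.eq_zero_of_abs_lt_dvd (m := (b : ℤ)) ⟨n, h2⟩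
      rw [abs_lt]; constructor <;> omega
    omega
  have h1 : (1 : ℝ) ≤ |(y : ℝ) * b' - y' * b - n * b * b'| := by
    have := Int.one_le_abs hz
    exact_mod_cast this
  have h2 : (y : ℝ) / b - (y' : ℝ) / b' - n = ((y : ℝ) * b' - y' * b - n * b * b') / (b * b') := by
    field_simp
  rw [h2, abs_div, abs_of_pos (mul_pos p1 p2)]
  have q1 : (b : ℝ) ≤ B := by exact_mod_cast hbB
  have q2 : (b' : ℝ) ≤ B := by exact_mod_cast hbB'
  have h3 : (b : ℝ) * b' ≤ (B : ℝ) ^ 2 := by nlinarith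
  gcongr

/-- The classical additive large sieve inequality. -/
theorem additive_large_sieve (N M B : ℕ) (a : ℕ → ℂ) :
    ∑ b ∈ Finset.Icc 1 B, ∑ x ∈ (Finset.range b).filter (fun x => Nat.Coprime x b),
      ‖∑ m ∈ Finset.Ico N (N + M), a m * e ((x * m : ℕ) / (b : ℝ))‖ ^ 2
    ≤ ((B : ℝ) ^ 2 + M) * ∑ m ∈ Finset.Ico N (N + M), ‖a m‖ ^ 2 := by
  rcases Nat.eq_zero_or_pos B with hB | hB
  · subst hB
    simp only [Finset.Icc_eq_empty_of_lt Nat.zero_lt_one, Finset.sum_empty]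
    positivity
  have hB' : (0 : ℝ) < B := by exact_mod_cast hB
  rw [Finset.sum_sigma']
  set F : Finset (Σ _ : ℕ, ℕ) := (Finset.Icc 1 B).sigma
    (fun b => (Finset.range b).filter (fun x => Nat.Coprime x b)) with hF
  have hmem : ∀ p : F, 1 ≤ p.1.1 ∧ p.1.1 ≤ B ∧ p.1.2 < p.1.1 ∧ Nat.Coprime p.1.2 p.1.1 := by
    intro p
    have := Finset.mem_sigma.mp p.2
    rw [Finset.mem_Icc, Finset.mem_filter, Finset.mem_range] at this
    exact ⟨this.1.1, this.1.2, this.2.1, this.2.2⟩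
  have hg := ls_general (ι := F) (fun p => (p.1.2 : ℝ) / (p.1.1 : ℝ)) (1 / (B : ℝ) ^ 2)
    (by positivity) (by
      intro r s hrs n
      obtain ⟨r1, r2, r3, r4⟩ := hmem r
      obtain ⟨s1, s2, s3, s4⟩ := hmem s
      refine ls_farey B r.1.1 s.1.1 r.1.2 s.1.2 r1 s1 r2 s2 r3 s3 r4 s4 ?_ n
      rintro ⟨h1, h2⟩
      exact hrs (Subtype.ext (Sigma.ext h1 (heq_of_eq h2)))) N M a
  rw [one_div_one_div, add_comm (M : ℝ)] at hg
  refine le_trans (le_of_eq ?_) hg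
  rw [← Finset.sum_coe_sort F]
  refine Finset.sum_congr rfl fun p _ => ?_
  congr 2
  refine Finset.sum_congr rfl fun m _ => ?_
  congr 2
  push_cast
  ring
end

section
/- Let λ_j(n) be a multiplicative arithmetic function satisfying the Hecke relations λ_j(m)λ_j(n) = Σ_{d | gcd(m,n)} λ_j(mn/d²). Then for Re(s) sufficiently large, (Σ_{n≥1} λ_j(n) n^{−s})³ = Σ_{a,b ≥ 1} μ(a) d₃(b) (ab)^{−2s} Σ_{n≥1} d₃(n) λ_j(an) (an)^{−s}, where d₃(n) = Σ_{abc=n} 1 is the triple divisor function and μ is the Möbius function. -/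
open Finset

/-- The triple divisor function `d₃(n) = ∑_{abc = n} 1`. -/
def d3 (n : ℕ) : ℕ := ∑ a ∈ n.divisors, (n / a).divisors.card

noncomputable def cc (n : ℕ) : ℝ := ((n : ℝ)⁻¹) ^ 2

lemma cc_zero : cc 0 = 0 := by simp [cc]
lemma cc_nonneg (n : ℕ) : 0 ≤ cc n := by unfold cc; positivity
lemma cc_summable : Summable cc := by
  have : Summable (fun n : ℕ => ((n : ℝ) ^ 2)⁻¹) := Real.summable_nat_pow_inv.2 (by norm_num)
  refine this.congr fun n => ?_
  rw [cc, inv_pow]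

lemma sum2 {F : ℕ → ℕ → ℂ} (h : ∀ m n, ‖F m n‖ ≤ cc m * cc n) :
    Summable (fun p : ℕ × ℕ => F p.1 p.2) :=
  Summable.of_norm_bounded
    (cc_summable.mul_of_nonneg cc_summable cc_nonneg cc_nonneg) (fun p => h p.1 p.2)

lemma sum3 {F : ℕ → ℕ → ℕ → ℂ} (h : ∀ d m n, ‖F d m n‖ ≤ cc d * cc m * cc n) :
    Summable (fun p : ℕ × ℕ × ℕ => F p.1 p.2.1 p.2.2) := by
  refine Summable.of_norm_bounded (g := fun p : ℕ × ℕ × ℕ => cc p.1 * (cc p.2.1 * cc p.2.2))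
    (cc_summable.mul_of_nonneg
      (cc_summable.mul_of_nonneg cc_summable cc_nonneg cc_nonneg) cc_nonneg
      (fun p => mul_nonneg (cc_nonneg _) (cc_nonneg _))) (fun p => ?_)
  rw [← mul_assoc]; exact h _ _ _

lemma T2 {F : ℕ → ℕ → ℂ} (h : ∀ m n, ‖F m n‖ ≤ cc m * cc n) :
    ∑' p : ℕ × ℕ, F p.1 p.2 = ∑' m, ∑' n, F m n := (sum2 h).tsum_prod

lemma T3 {F : ℕ → ℕ → ℕ → ℂ} (h : ∀ d m n, ‖F d m n‖ ≤ cc d * cc m * cc n) :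
    ∑' p : ℕ × ℕ × ℕ, F p.1 p.2.1 p.2.2 = ∑' d, ∑' p : ℕ × ℕ, F d p.1 p.2 :=
  (sum3 h).tsum_prod

lemma T3' {F : ℕ → ℕ → ℕ → ℂ} (h : ∀ d m n, ‖F d m n‖ ≤ cc d * cc m * cc n) :
    ∑' p : ℕ × ℕ × ℕ, F p.1 p.2.1 p.2.2 = ∑' n, ∑' p : ℕ × ℕ, F p.1 p.2 n := by
  let e : ℕ × ℕ × ℕ ≃ ℕ × ℕ × ℕ :=
    ⟨fun x => (x.2.1, x.2.2, x.1), fun x => (x.2.2, x.1, x.2.1), fun _ => rfl, fun _ => rfl⟩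
  rw [← e.tsum_eq]
  exact ((e.summable_iff).2 (sum3 h)).tsum_prod

lemma LA {F : ℕ → ℕ → ℕ → ℂ} (h : ∀ d m n, ‖F d m n‖ ≤ cc d * cc m * cc n) :
    ∑' p : ℕ × ℕ, ∑ d ∈ (Nat.gcd p.1 p.2).divisors, F d (p.1 / d) (p.2 / d)
      = ∑' p : ℕ × ℕ × ℕ, F p.1 p.2.1 p.2.2 := by
  have z1 : ∀ m n, F 0 m n = 0 := fun m n => by simpa [cc_zero] using h 0 m n
  have z2 : ∀ d n, F d 0 n = 0 := fun m n => by simpa [cc_zero] using h m 0 n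
  have z3 : ∀ d m, F d m 0 = 0 := fun m n => by simpa [cc_zero] using h m n 0
  have key := (sum3 h).hasSum.tsum_fiberwise (fun x : ℕ × ℕ × ℕ => (x.1 * x.2.1, x.1 * x.2.2))
  rw [← key.tsum_eq]
  refine tsum_congr fun p => ?_
  obtain ⟨M, N⟩ := p
  rw [_root_.tsum_subtype (f := fun p : ℕ × ℕ × ℕ => F p.1 p.2.1 p.2.2)]
  rw [tsum_eq_sum (s := (Nat.gcd M N).divisors.image (fun d => (d, M / d, N / d)))]
  · rw [Finset.sum_image (by intro a _ b _ hab; simpa using congrArg Prod.fst hab)]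
    refine Finset.sum_congr rfl fun d hd => ?_
    have hd' := Nat.dvd_of_mem_divisors hd
    rw [Set.indicator_of_mem]
    simp [Nat.mul_div_cancel' (hd'.trans (Nat.gcd_dvd_left M N)),
      Nat.mul_div_cancel' (hd'.trans (Nat.gcd_dvd_right M N))]
  · rintro ⟨d, m, n⟩ hx
    by_cases hmem : (⟨d, m, n⟩ : ℕ × ℕ × ℕ) ∈
        (fun x : ℕ × ℕ × ℕ => (x.1 * x.2.1, x.1 * x.2.2)) ⁻¹' {(M, N)}
    · rw [Set.indicator_of_mem hmem]
      simp only [Set.mem_preimage, Set.mem_singleton_iff, Prod.mk.injEq] at hmem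
      obtain ⟨rfl, rfl⟩ := hmem
      rcases Nat.eq_zero_or_pos d with rfl | hd
      · exact z1 _ _
      rcases Nat.eq_zero_or_pos m with rfl | hm
      · exact z2 _ _
      exfalso; apply hx
      rw [Finset.mem_image]
      refine ⟨d, ?_, ?_⟩
      · rw [Nat.mem_divisors]
        refine ⟨Nat.dvd_gcd (dvd_mul_right _ _) (dvd_mul_right _ _), ?_⟩
        exact (Nat.gcd_pos_of_pos_left _ (Nat.mul_pos hd hm)).ne'
      · simp [Nat.mul_div_cancel_left _ hd]
    · exact Set.indicator_of_notMem hmem _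

lemma LB {F : ℕ → ℕ → ℂ} (h : ∀ m n, ‖F m n‖ ≤ cc m * cc n) :
    ∑' N : ℕ, ∑ p ∈ N.divisorsAntidiagonal, F p.1 p.2 = ∑' p : ℕ × ℕ, F p.1 p.2 := by
  have z1 : ∀ n, F 0 n = 0 := fun n => by simpa [cc_zero] using h 0 n
  have z2 : ∀ n, F n 0 = 0 := fun n => by simpa [cc_zero] using h n 0
  have key := (sum2 h).hasSum.tsum_fiberwise (fun x : ℕ × ℕ => x.1 * x.2)
  rw [← key.tsum_eq]
  refine tsum_congr fun N => ?_
  rw [_root_.tsum_subtype (f := fun p : ℕ × ℕ => F p.1 p.2)]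
  rw [tsum_eq_sum (s := N.divisorsAntidiagonal)]
  · refine Finset.sum_congr rfl fun d hd => ?_
    rw [Set.indicator_of_mem]
    simpa using (Nat.mem_divisorsAntidiagonal.1 hd).1
  · rintro ⟨m, n⟩ hx
    by_cases hmem : (⟨m, n⟩ : ℕ × ℕ) ∈ (fun x : ℕ × ℕ => x.1 * x.2) ⁻¹' {N}
    · rw [Set.indicator_of_mem hmem]
      simp only [Set.mem_preimage, Set.mem_singleton_iff] at hmem
      subst hmem
      rcases Nat.eq_zero_or_pos m with rfl | hd
      · exact z1 _
      rcases Nat.eq_zero_or_pos n with rfl | hm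
      · exact z2 _
      exfalso; apply hx
      simp [hd.ne', hm.ne']
    · exact Set.indicator_of_notMem hmem _

/-- Divisor function of a product. -/
lemma card_divisors_mul_eq (e n : ℕ) (he : 0 < e) (hn : 0 < n) :
    ((e * n).divisors.card : ℤ) = ∑ a ∈ (Nat.gcd e n).divisors,
      ArithmeticFunction.moebius a * ((e / a).divisors.card * (n / a).divisors.card) := by
  have h1 : (e * n).divisors.card =
      ((e.divisors ×ˢ n.divisors).filter (fun p => Nat.gcd (e / p.1) p.2 = 1)).card := by
    symm
    refine Finset.card_bij' (fun p _ => p.1 * p.2) (fun u _ => (Nat.gcd u e, u / Nat.gcd u e))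
      ?_ ?_ ?_ ?_
    · rintro ⟨x, y⟩ hp
      simp only [mem_filter, mem_product, Nat.mem_divisors] at hp ⊢
      exact ⟨mul_dvd_mul hp.1.1.1 hp.1.2.1, by positivity⟩
    · intro u hu
      simp only [mem_filter, mem_product, Nat.mem_divisors] at hu ⊢
      have hu0 : 0 < u := Nat.pos_of_dvd_of_pos hu.1 (by positivity)
      have hg : 0 < Nat.gcd u e := Nat.gcd_pos_of_pos_left _ hu0
      have hco := Nat.coprime_div_gcd_div_gcd hg
      refine ⟨⟨⟨Nat.gcd_dvd_right _ _, he.ne'⟩, ?_, hn.ne'⟩, hco.symm⟩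
      refine hco.dvd_of_dvd_mul_left ?_
      apply Nat.dvd_of_mul_dvd_mul_left hg
      rw [← mul_assoc, Nat.mul_div_cancel' (Nat.gcd_dvd_left _ _),
        Nat.mul_div_cancel' (Nat.gcd_dvd_right _ _)]
      exact hu.1
    · rintro ⟨x, y⟩ hp
      simp only [mem_filter, mem_product, Nat.mem_divisors] at hp
      obtain ⟨⟨⟨⟨k, rfl⟩, -⟩, hy, -⟩, hc⟩ := hp
      have hx : 0 < x := Nat.pos_of_mul_pos_right he
      rw [Nat.mul_div_cancel_left _ hx] at hc
      have : Nat.gcd (x * y) (x * k) = x := by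
        rw [Nat.gcd_mul_left, Nat.gcd_comm, hc, mul_one]
      simp [this, Nat.mul_div_cancel_left _ hx]
    · intro u hu
      exact Nat.mul_div_cancel' (Nat.gcd_dvd_left _ _)
  rw [h1, Finset.card_filter]
  push_cast
  have h2 : ∀ p ∈ e.divisors ×ˢ n.divisors, (if Nat.gcd (e / p.1) p.2 = 1 then (1 : ℤ) else 0)
      = ∑ a ∈ (Nat.gcd (e / p.1) p.2).divisors, ArithmeticFunction.moebius a := by
    intro p _
    have := congrArg (fun f => f (Nat.gcd (e / p.1) p.2))
      ArithmeticFunction.moebius_mul_coe_zeta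
    rw [ArithmeticFunction.coe_mul_zeta_apply, ArithmeticFunction.one_apply] at this
    exact this.symm
  rw [Finset.sum_congr rfl h2, Finset.sum_sigma']
  have h3 : ∀ a ∈ (Nat.gcd e n).divisors,
      ArithmeticFunction.moebius a * (((e / a).divisors.card : ℤ) * (n / a).divisors.card)
      = ∑ p ∈ (e / a).divisors ×ˢ (n / a).divisors, ArithmeticFunction.moebius a := by
    intro a _
    rw [Finset.sum_const, Finset.card_product]; simp; ring
  rw [Finset.sum_congr rfl h3, Finset.sum_sigma']
  clear h1 h2 h3
  refine Finset.sum_bij' (fun x _ => ⟨x.2, (x.1.1, x.1.2 / x.2)⟩)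
    (fun x _ => ⟨(x.2.1, x.1 * x.2.2), x.1⟩) ?_ ?_ ?_ ?_ ?_
  · rintro ⟨⟨x, y⟩, a⟩ hx
    simp only [mem_sigma, mem_product, Nat.mem_divisors, Nat.dvd_gcd_iff] at hx ⊢
    obtain ⟨⟨⟨⟨k, rfl⟩, -⟩, ⟨l, rfl⟩, -⟩, ⟨g1, ⟨j, rfl⟩⟩, -⟩ := hx
    have hx : 0 < x := Nat.pos_of_mul_pos_right he
    rw [Nat.mul_div_cancel_left _ hx] at g1
    obtain ⟨i, rfl⟩ := g1
    have ha : 0 < a := by by_contra h; simp_all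
    have e1 : x * (a * i) / a = x * i := by
      rw [show x * (a * i) = a * (x * i) by ring, Nat.mul_div_cancel_left _ ha]
    have e2 : a * j * l / a = j * l := by rw [mul_assoc, Nat.mul_div_cancel_left _ ha]
    rw [e1, e2, Nat.mul_div_cancel_left _ ha]
    refine ⟨⟨⟨⟨x * i, by ring⟩, ⟨j * l, by ring⟩⟩, ?_⟩, ⟨⟨i, rfl⟩, ?_⟩, ⟨l, rfl⟩, ?_⟩
    · exact (Nat.gcd_pos_of_pos_left _ he).ne'
    · rintro h; rw [show x * (a * i) = a * (x * i) by ring, h] at he; simp at he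
    · rintro h; rw [mul_assoc, h] at hn; simp at hn
  · rintro ⟨a, ⟨x, y⟩⟩ hx
    simp only [mem_sigma, mem_product, Nat.mem_divisors, Nat.dvd_gcd_iff] at hx ⊢
    obtain ⟨⟨⟨⟨k, rfl⟩, ⟨l, rfl⟩⟩, -⟩, ⟨g1, -⟩, g2, -⟩ := hx
    have ha : 0 < a := Nat.pos_of_mul_pos_right he
    rw [Nat.mul_div_cancel_left _ ha] at g1 g2
    obtain ⟨i, rfl⟩ := g1
    obtain ⟨j, rfl⟩ := g2
    have hx : 0 < x := by by_contra h; simp_all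
    have e1 : a * (x * i) / x = a * i := by
      rw [show a * (x * i) = x * (a * i) by ring, Nat.mul_div_cancel_left _ hx]
    rw [e1]
    refine ⟨⟨⟨⟨a * i, by ring⟩, he.ne'⟩, ⟨j, by ring⟩, hn.ne'⟩, ⟨⟨i, rfl⟩, ⟨y, rfl⟩⟩, ?_⟩
    apply (Nat.gcd_pos_of_pos_left _ _).ne'
    by_contra h
    have : a * i = 0 := by omega
    rw [show a * (x * i) = x * (a * i) by ring, this] at he; simp at he
  · rintro ⟨⟨x, y⟩, a⟩ hx
    simp only [mem_sigma, mem_product, Nat.mem_divisors, Nat.dvd_gcd_iff] at hx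
    simp [Nat.mul_div_cancel' hx.2.1.2]
  · rintro ⟨a, ⟨x, y⟩⟩ hx
    simp only [mem_sigma, mem_product, Nat.mem_divisors, Nat.dvd_gcd_iff] at hx
    have ha : 0 < a := Nat.pos_of_dvd_of_pos hx.1.1.1 he
    simp [Nat.mul_div_cancel_left _ ha]
  · rintro ⟨⟨x, y⟩, a⟩ hx
    rfl

noncomputable def qq (n : ℕ) : ℝ := (n : ℝ)⁻¹

lemma qq_nonneg (n : ℕ) : 0 ≤ qq n := by unfold qq; positivity

lemma PP (n i j : ℕ) (h : i + 2 ≤ j) : (n : ℝ) ^ i * qq n ^ j ≤ cc n := by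
  obtain ⟨k, rfl⟩ := Nat.exists_eq_add_of_le h
  rcases Nat.eq_zero_or_pos n with rfl | hn
  · simp [qq, cc]
  · have h1 : (n : ℝ) ^ i * qq n ^ (i + 2 + k) = cc n * qq n ^ k := by
      have hn0 : (n : ℝ) ≠ 0 := by exact_mod_cast hn.ne'
      have h3 : (n : ℝ) ^ i * ((n : ℝ)⁻¹) ^ i = 1 := by
        rw [← mul_pow, mul_inv_cancel₀ hn0, one_pow]
      unfold qq cc
      rw [pow_add, pow_add, ← mul_assoc, ← mul_assoc, h3, one_mul]
    rw [h1]
    have h2 : qq n ^ k ≤ 1 := by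
      apply pow_le_one₀ (qq_nonneg n)
      unfold qq
      exact inv_le_one_of_one_le₀ (by exact_mod_cast hn)
    nlinarith [cc_nonneg n]

lemma cc_le_one (n : ℕ) : cc n ≤ 1 := by
  unfold cc
  rcases Nat.eq_zero_or_pos n with rfl | hn
  · simp
  · apply pow_le_one₀ (by positivity)
    exact inv_le_one_of_one_le₀ (by exact_mod_cast hn)

noncomputable def tau (n : ℕ) : ℂ := (n.divisors.card : ℂ)

lemma tau_norm (n : ℕ) : ‖tau n‖ ≤ n := by
  unfold tau
  rw [Complex.norm_natCast]
  exact_mod_cast Nat.card_divisors_le_self n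

lemma tau_eq (n : ℕ) : tau n = ∑ p ∈ n.divisorsAntidiagonal, (1 : ℂ) := by
  rw [tau, Finset.sum_const, ← Nat.map_div_right_divisors, Finset.card_map]; simp

lemma d3_eq (n : ℕ) : (d3 n : ℂ) = ∑ p ∈ n.divisorsAntidiagonal, tau p.2 := by
  rw [Nat.sum_divisorsAntidiagonal (f := fun _ y => tau y)]
  simp [d3, tau]

lemma moeb_norm (a : ℕ) : ‖((ArithmeticFunction.moebius a : ℤ) : ℂ)‖ ≤ 1 := by
  rw [Complex.norm_intCast]
  exact_mod_cast ArithmeticFunction.abs_moebius_le_one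

lemma tau_mul (e n : ℕ) (he : 0 < e) (hn : 0 < n) :
    tau (e * n) = ∑ a ∈ (Nat.gcd e n).divisors,
      ((ArithmeticFunction.moebius a : ℤ) : ℂ) * (tau (e / a) * tau (n / a)) := by
  have := congrArg (fun z : ℤ => (z : ℂ)) (card_divisors_mul_eq e n he hn)
  push_cast at this
  exact this

section
variable {lam w : ℕ → ℂ}

/-- `L² = ζ(2s) · ∑ τ(n) λ(n) n^{-s}`. -/
lemma step1 (hecke : ∀ m n : ℕ, 0 < m → 0 < n →
      lam m * lam n = ∑ d ∈ (Nat.gcd m n).divisors, lam (m * n / d ^ 2))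
    (hl : ∀ n, ‖lam n‖ ≤ n) (hw : ∀ n, ‖w n‖ ≤ qq n ^ 6)
    (hwm : ∀ m n, w (m * n) = w m * w n) :
    (∑' n, lam n * w n) * (∑' n, lam n * w n)
      = (∑' d, w d ^ 2) * ∑' n, tau n * lam n * w n := by
  have w0 : w 0 = 0 := by simpa [qq] using hw 0
  have b0 : ∀ m n, ‖(lam m * w m) * (lam n * w n)‖ ≤ cc m * cc n := by
    intro m n
    calc _ = ‖lam m‖ * ‖w m‖ * (‖lam n‖ * ‖w n‖) := by simp only [norm_mul]
      _ ≤ (m : ℝ) * qq m ^ 6 * ((n : ℝ) * qq n ^ 6) := by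
        gcongr <;> first | apply hl | apply hw
      _ = ((m : ℝ) ^ 1 * qq m ^ 6) * ((n : ℝ) ^ 1 * qq n ^ 6) := by ring
      _ ≤ _ := by
        have := qq_nonneg m; have := qq_nonneg n; have := cc_nonneg m
        gcongr <;> exact PP _ _ _ (by norm_num)
  have b1 : ∀ d m n, ‖lam (m * n) * w d ^ 2 * w m * w n‖ ≤ cc d * cc m * cc n := by
    intro d m n
    have := qq_nonneg d; have := qq_nonneg m; have := qq_nonneg n
    have := cc_nonneg d; have := cc_nonneg m
    calc _ = ‖lam (m * n)‖ * ‖w d‖ ^ 2 * ‖w m‖ * ‖w n‖ := by simp only [norm_mul, norm_pow]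
      _ ≤ ((m * n : ℕ) : ℝ) * (qq d ^ 6) ^ 2 * qq m ^ 6 * qq n ^ 6 := by
        gcongr <;> first | apply hl | apply hw
      _ = ((d : ℝ) ^ 0 * qq d ^ 12) * ((m : ℝ) ^ 1 * qq m ^ 6) * ((n : ℝ) ^ 1 * qq n ^ 6) := by
        push_cast; ring
      _ ≤ _ := by
        gcongr <;> exact PP _ _ _ (by norm_num)
  have b2 : ∀ m n, ‖lam (m * n) * w (m * n)‖ ≤ cc m * cc n := by
    intro m n
    have := qq_nonneg m; have := qq_nonneg n; have := cc_nonneg m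
    rw [hwm]
    calc _ = ‖lam (m * n)‖ * (‖w m‖ * ‖w n‖) := by simp only [norm_mul]
      _ ≤ ((m * n : ℕ) : ℝ) * (qq m ^ 6 * qq n ^ 6) := by
        gcongr <;> first | apply hl | apply hw
      _ = ((m : ℝ) ^ 1 * qq m ^ 6) * ((n : ℝ) ^ 1 * qq n ^ 6) := by push_cast; ring
      _ ≤ _ := by gcongr <;> exact PP _ _ _ (by norm_num)
  have e1 : (∑' n, lam n * w n) * (∑' n, lam n * w n)
      = ∑' p : ℕ × ℕ, (lam p.1 * w p.1) * (lam p.2 * w p.2) := by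
    rw [T2 b0]; simp_rw [tsum_mul_left, tsum_mul_right]
  rw [e1]
  have e2 : ∀ p : ℕ × ℕ, (lam p.1 * w p.1) * (lam p.2 * w p.2) =
      ∑ d ∈ (Nat.gcd p.1 p.2).divisors,
        lam ((p.1 / d) * (p.2 / d)) * w d ^ 2 * w (p.1 / d) * w (p.2 / d) := by
    rintro ⟨m, n⟩
    rcases Nat.eq_zero_or_pos m with rfl | hm
    · simp [w0]
    rcases Nat.eq_zero_or_pos n with rfl | hn
    · simp [w0]
    calc _ = (lam m * lam n) * (w m * w n) := by ring
      _ = _ := by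
        rw [hecke m n hm hn, Finset.sum_mul]
        refine Finset.sum_congr rfl fun d hd => ?_
        have hd' := Nat.dvd_of_mem_divisors hd
        obtain ⟨i, rfl⟩ := hd'.trans (Nat.gcd_dvd_left m n)
        obtain ⟨j, rfl⟩ := hd'.trans (Nat.gcd_dvd_right _ n)
        have hd0 : 0 < d := Nat.pos_of_mul_pos_right hm
        simp only [Nat.mul_div_cancel_left _ hd0]
        rw [show d * i * (d * j) = d ^ 2 * (i * j) by ring, Nat.mul_div_cancel_left _ (by positivity),
          hwm, hwm]
        ring
  rw [tsum_congr e2, LA b1, T3 b1, ← tsum_mul_right]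
  refine tsum_congr fun d => ?_
  have e3 : ∀ N, tau N * lam N * w N
      = ∑ p ∈ N.divisorsAntidiagonal, lam (p.1 * p.2) * w (p.1 * p.2) := by
    intro N
    rw [tau_eq, Finset.sum_mul, Finset.sum_mul]
    refine Finset.sum_congr rfl fun p hp => ?_
    rw [(Nat.mem_divisorsAntidiagonal.1 hp).1, one_mul]
  rw [tsum_congr e3, LB b2, ← tsum_mul_left]
  refine tsum_congr fun p => ?_
  rw [hwm]; ring

lemma step2 (hecke : ∀ m n : ℕ, 0 < m → 0 < n →
      lam m * lam n = ∑ d ∈ (Nat.gcd m n).divisors, lam (m * n / d ^ 2))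
    (hl : ∀ n, ‖lam n‖ ≤ n) (hw : ∀ n, ‖w n‖ ≤ qq n ^ 6)
    (hwm : ∀ m n, w (m * n) = w m * w n) :
    (∑' n, tau n * lam n * w n) * (∑' n, lam n * w n)
      = ∑' n, ∑' p : ℕ × ℕ, tau (p.1 * p.2) * lam (p.2 * n) * w p.1 ^ 2 * w p.2 * w n := by
  have w0 : w 0 = 0 := by simpa [qq] using hw 0
  have b0 : ∀ m n, ‖(tau m * lam m * w m) * (lam n * w n)‖ ≤ cc m * cc n := by
    intro m n
    have := qq_nonneg m; have := qq_nonneg n; have := cc_nonneg m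
    calc _ = ‖tau m‖ * ‖lam m‖ * ‖w m‖ * (‖lam n‖ * ‖w n‖) := by simp only [norm_mul]
      _ ≤ (m : ℝ) * (m : ℝ) * qq m ^ 6 * ((n : ℝ) * qq n ^ 6) := by
        gcongr <;> first | apply hl | apply hw | apply tau_norm
      _ = ((m : ℝ) ^ 2 * qq m ^ 6) * ((n : ℝ) ^ 1 * qq n ^ 6) := by ring
      _ ≤ _ := by
        gcongr <;> exact PP _ _ _ (by norm_num)
  have b1 : ∀ d m n, ‖tau (d * m) * lam (m * n) * w d ^ 2 * w m * w n‖
      ≤ cc d * cc m * cc n := by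
    intro d m n
    have := qq_nonneg d; have := qq_nonneg m; have := qq_nonneg n
    have := cc_nonneg d; have := cc_nonneg m
    calc _ = ‖tau (d * m)‖ * ‖lam (m * n)‖ * ‖w d‖ ^ 2 * ‖w m‖ * ‖w n‖ := by
          simp only [norm_mul, norm_pow]
      _ ≤ ((d * m : ℕ) : ℝ) * ((m * n : ℕ) : ℝ) * (qq d ^ 6) ^ 2 * qq m ^ 6 * qq n ^ 6 := by
        gcongr <;> first | apply hl | apply hw | apply tau_norm
      _ = ((d : ℝ) ^ 1 * qq d ^ 12) * ((m : ℝ) ^ 2 * qq m ^ 6) * ((n : ℝ) ^ 1 * qq n ^ 6) := by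
        push_cast; ring
      _ ≤ _ := by
        gcongr <;> exact PP _ _ _ (by norm_num)
  have e1 : (∑' n, tau n * lam n * w n) * (∑' n, lam n * w n)
      = ∑' p : ℕ × ℕ, (tau p.1 * lam p.1 * w p.1) * (lam p.2 * w p.2) := by
    rw [T2 b0]; simp_rw [tsum_mul_left, tsum_mul_right]
  rw [e1]
  have e2 : ∀ p : ℕ × ℕ, (tau p.1 * lam p.1 * w p.1) * (lam p.2 * w p.2) =
      ∑ d ∈ (Nat.gcd p.1 p.2).divisors,
        tau (d * (p.1 / d)) * lam ((p.1 / d) * (p.2 / d)) * w d ^ 2 * w (p.1 / d)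
          * w (p.2 / d) := by
    rintro ⟨m, n⟩
    rcases Nat.eq_zero_or_pos m with rfl | hm
    · simp [w0]
    rcases Nat.eq_zero_or_pos n with rfl | hn
    · simp [w0]
    calc _ = (lam m * lam n) * (tau m * w m * w n) := by ring
      _ = _ := by
        rw [hecke m n hm hn, Finset.sum_mul]
        refine Finset.sum_congr rfl fun d hd => ?_
        have hd' := Nat.dvd_of_mem_divisors hd
        obtain ⟨i, rfl⟩ := hd'.trans (Nat.gcd_dvd_left m n)
        obtain ⟨j, rfl⟩ := hd'.trans (Nat.gcd_dvd_right _ n)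
        have hd0 : 0 < d := Nat.pos_of_mul_pos_right hm
        simp only [Nat.mul_div_cancel_left _ hd0]
        rw [show d * i * (d * j) = d ^ 2 * (i * j) by ring, Nat.mul_div_cancel_left _ (by positivity),
          hwm, hwm]
        ring
  rw [tsum_congr e2, LA b1, T3' b1]

lemma step3 (hl : ∀ n, ‖lam n‖ ≤ n) (hw : ∀ n, ‖w n‖ ≤ qq n ^ 6)
    (hwm : ∀ m n, w (m * n) = w m * w n) :
    ∑' n, ∑' p : ℕ × ℕ, tau (p.1 * p.2) * lam (p.2 * n) * w p.1 ^ 2 * w p.2 * w n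
      = ∑' a, ((ArithmeticFunction.moebius a : ℤ) : ℂ) * w a ^ 2 * (∑' e, tau e * w e ^ 2)
          * ∑' n, (d3 n : ℂ) * lam (a * n) * w (a * n) := by
  have w0 : w 0 = 0 := by simpa [qq] using hw 0
  have b1 : ∀ n a e k, ‖((ArithmeticFunction.moebius a : ℤ) : ℂ) * (tau e * tau k)
      * lam (a * k * n) * w (a * e) ^ 2 * w (a * k) * w n‖ ≤ cc n * (cc a * cc e * cc k) := by
    intro n a e k
    have := qq_nonneg a; have := qq_nonneg e; have := qq_nonneg k; have := qq_nonneg n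
    have := cc_nonneg a; have := cc_nonneg e; have := cc_nonneg n
    rw [hwm, hwm]
    calc _ = ‖((ArithmeticFunction.moebius a : ℤ) : ℂ)‖ * (‖tau e‖ * ‖tau k‖)
          * ‖lam (a * k * n)‖ * (‖w a‖ * ‖w e‖) ^ 2 * (‖w a‖ * ‖w k‖) * ‖w n‖ := by
          simp only [norm_mul, norm_pow]
      _ ≤ 1 * ((e : ℝ) * (k : ℝ)) * ((a * k * n : ℕ) : ℝ) * (qq a ^ 6 * qq e ^ 6) ^ 2
          * (qq a ^ 6 * qq k ^ 6) * qq n ^ 6 := by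
        gcongr <;> first | apply hl | apply hw | apply tau_norm | apply moeb_norm
      _ = ((n : ℝ) ^ 1 * qq n ^ 6) * (((a : ℝ) ^ 1 * qq a ^ 18) * ((e : ℝ) ^ 1 * qq e ^ 12)
          * ((k : ℝ) ^ 2 * qq k ^ 6)) := by
        push_cast; ring
      _ ≤ _ := by
        have := cc_nonneg k
        gcongr <;> exact PP _ _ _ (by norm_num)
  have b1' : ∀ n a e k, ‖((ArithmeticFunction.moebius a : ℤ) : ℂ) * (tau e * tau k)
      * lam (a * k * n) * w (a * e) ^ 2 * w (a * k) * w n‖ ≤ cc a * cc e * cc k := by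
    intro n a e k
    refine (b1 n a e k).trans ?_
    have := mul_nonneg (mul_nonneg (cc_nonneg a) (cc_nonneg e)) (cc_nonneg k)
    nlinarith [cc_le_one n]
  have b3 : ∀ a n k, ‖tau k * lam (a * (n * k)) * w (a * (n * k))‖ ≤ cc a * (cc n * cc k) := by
    intro a n k
    have := qq_nonneg a; have := qq_nonneg k; have := qq_nonneg n
    have := cc_nonneg a; have := cc_nonneg n
    rw [hwm, hwm]
    calc _ = ‖tau k‖ * ‖lam (a * (n * k))‖ * (‖w a‖ * (‖w n‖ * ‖w k‖)) := by
          simp only [norm_mul]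
      _ ≤ (k : ℝ) * ((a * (n * k) : ℕ) : ℝ) * (qq a ^ 6 * (qq n ^ 6 * qq k ^ 6)) := by
        gcongr <;> first | apply hl | apply hw | apply tau_norm
      _ = ((a : ℝ) ^ 1 * qq a ^ 6) * (((n : ℝ) ^ 1 * qq n ^ 6) * ((k : ℝ) ^ 2 * qq k ^ 6)) := by
        push_cast; ring
      _ ≤ _ := by
        gcongr <;> exact PP _ _ _ (by norm_num)
  have b3' : ∀ a n k, ‖tau k * lam (a * (n * k)) * w (a * (n * k))‖ ≤ cc n * cc k := by
    intro a n k
    refine (b3 a n k).trans ?_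
    have := mul_nonneg (cc_nonneg n) (cc_nonneg k)
    nlinarith [cc_le_one a]
  have e1 : ∀ n, ∀ p : ℕ × ℕ, tau (p.1 * p.2) * lam (p.2 * n) * w p.1 ^ 2 * w p.2 * w n
      = ∑ a ∈ (Nat.gcd p.1 p.2).divisors, ((ArithmeticFunction.moebius a : ℤ) : ℂ)
        * (tau (p.1 / a) * tau (p.2 / a)) * lam (a * (p.2 / a) * n) * w (a * (p.1 / a)) ^ 2
        * w (a * (p.2 / a)) * w n := by
    rintro n ⟨e, m⟩
    rcases Nat.eq_zero_or_pos m with rfl | hm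
    · simp [w0]
    rcases Nat.eq_zero_or_pos e with rfl | he
    · simp [w0]
    simp only
    rw [tau_mul e m he hm]
    simp only [Finset.sum_mul]
    refine Finset.sum_congr rfl fun d hd => ?_
    have hd' := Nat.dvd_of_mem_divisors hd
    rw [Nat.mul_div_cancel' (hd'.trans (Nat.gcd_dvd_left e m)),
      Nat.mul_div_cancel' (hd'.trans (Nat.gcd_dvd_right e m))]
  have b4 : ∀ a n k, ‖((ArithmeticFunction.moebius a : ℤ) : ℂ) * w a ^ 2
      * (tau k * lam (a * (n * k)) * w (a * (n * k)))‖ ≤ cc a * cc n * cc k := by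
    intro a n k
    have h0 : 0 ≤ cc a := cc_nonneg a
    have h1 : ‖((ArithmeticFunction.moebius a : ℤ) : ℂ) * w a ^ 2‖ ≤ 1 := by
      rw [norm_mul, norm_pow]
      have h2 : ‖w a‖ ≤ 1 := by
        refine (hw a).trans (le_trans ?_ (cc_le_one a))
        simpa using PP a 0 6 (by norm_num)
      have h3 : ‖w a‖ ^ 2 ≤ 1 := pow_le_one₀ (norm_nonneg _) h2
      exact mul_le_one₀ (moeb_norm a) (by positivity) h3
    rw [norm_mul]
    calc _ ≤ 1 * (cc a * (cc n * cc k)) := by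
          gcongr
          exact b3 a n k
      _ = _ := by ring
  have e2 : ∀ n, ∑' p : ℕ × ℕ, tau (p.1 * p.2) * lam (p.2 * n) * w p.1 ^ 2 * w p.2 * w n
      = (∑' e, tau e * w e ^ 2) * ∑' p : ℕ × ℕ, ((ArithmeticFunction.moebius p.1 : ℤ) : ℂ)
        * w p.1 ^ 2 * (tau p.2 * lam (p.1 * (n * p.2)) * w (p.1 * (n * p.2))) := by
    intro n
    have b5 : ∀ a k, ‖((ArithmeticFunction.moebius a : ℤ) : ℂ) * w a ^ 2
      * (tau k * lam (a * (n * k)) * w (a * (n * k)))‖ ≤ cc a * cc k := by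
      intro a k
      refine (b4 a n k).trans ?_
      have := mul_nonneg (cc_nonneg a) (cc_nonneg k)
      nlinarith [cc_le_one n]
    rw [tsum_congr (e1 n), LA (b1' n), T3 (b1' n), T2 b5, ← tsum_mul_left]
    refine tsum_congr fun a => ?_
    have b6 : ∀ e k, ‖((ArithmeticFunction.moebius a : ℤ) : ℂ) * (tau e * tau k)
      * lam (a * k * n) * w (a * e) ^ 2 * w (a * k) * w n‖ ≤ cc e * cc k := by
      intro e k
      refine (b1' n a e k).trans ?_
      have := mul_nonneg (cc_nonneg e) (cc_nonneg k)
      nlinarith [cc_le_one a]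
    rw [T2 b6, ← tsum_mul_right]
    refine tsum_congr fun e => ?_
    rw [← tsum_mul_left]
    refine tsum_congr fun k => ?_
    rw [show a * k * n = a * (n * k) by ring]
    simp only [hwm]; ring
  rw [tsum_congr e2, tsum_mul_left]
  have h4 := T3 (F := fun n a k => ((ArithmeticFunction.moebius a : ℤ) : ℂ) * w a ^ 2
      * (tau k * lam (a * (n * k)) * w (a * (n * k))))
      (fun n a k => (b4 a n k).trans_eq (by ring))
  have h5 := T3 b4
  let e : ℕ × ℕ × ℕ ≃ ℕ × ℕ × ℕ :=
    ⟨fun x => (x.2.1, x.1, x.2.2), fun x => (x.2.1, x.1, x.2.2), fun _ => rfl, fun _ => rfl⟩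
  have h6 := e.tsum_eq (fun p : ℕ × ℕ × ℕ => ((ArithmeticFunction.moebius p.1 : ℤ) : ℂ) * w p.1 ^ 2
      * (tau p.2.2 * lam (p.1 * (p.2.1 * p.2.2)) * w (p.1 * (p.2.1 * p.2.2))))
  rw [← h4]
  have h7 := h6.trans h5
  refine (congrArg _ h7).trans ?_
  rw [← tsum_mul_left]
  refine tsum_congr fun a => ?_
  rw [tsum_mul_left]
  have e3 : ∀ N, (d3 N : ℂ) * lam (a * N) * w (a * N)
      = ∑ p ∈ N.divisorsAntidiagonal, tau p.2 * lam (a * (p.1 * p.2)) * w (a * (p.1 * p.2)) := by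
    intro N
    rw [d3_eq, Finset.sum_mul, Finset.sum_mul]
    refine Finset.sum_congr rfl fun p hp => ?_
    rw [(Nat.mem_divisorsAntidiagonal.1 hp).1]
  rw [tsum_congr e3, LB (b3' a)]
  ring

lemma step4 (hw : ∀ n, ‖w n‖ ≤ qq n ^ 6) (hwm : ∀ m n, w (m * n) = w m * w n) :
    (∑' d, w d ^ 2) * (∑' e, tau e * w e ^ 2) = ∑' b, (d3 b : ℂ) * w b ^ 2 := by
  have b0 : ∀ m n, ‖w m ^ 2 * (tau n * w n ^ 2)‖ ≤ cc m * cc n := by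
    intro m n
    have := qq_nonneg m; have := qq_nonneg n; have := cc_nonneg m
    calc _ = ‖w m‖ ^ 2 * (‖tau n‖ * ‖w n‖ ^ 2) := by simp only [norm_mul, norm_pow]
      _ ≤ (qq m ^ 6) ^ 2 * ((n : ℝ) * (qq n ^ 6) ^ 2) := by
        gcongr <;> first | apply hw | apply tau_norm
      _ = ((m : ℝ) ^ 0 * qq m ^ 12) * ((n : ℝ) ^ 1 * qq n ^ 12) := by ring
      _ ≤ _ := by
        gcongr <;> exact PP _ _ _ (by norm_num)
  have e3 : ∀ N, (d3 N : ℂ) * w N ^ 2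
      = ∑ p ∈ N.divisorsAntidiagonal, w p.1 ^ 2 * (tau p.2 * w p.2 ^ 2) := by
    intro N
    rw [d3_eq, Finset.sum_mul]
    refine Finset.sum_congr rfl fun p hp => ?_
    rw [← (Nat.mem_divisorsAntidiagonal.1 hp).1, hwm]; ring
  rw [tsum_congr e3, LB b0, T2 b0]; simp_rw [tsum_mul_left, tsum_mul_right]

end

/-- For a multiplicative function `λ` satisfying the `GL(2)` Hecke relations
`λ(m)λ(n) = ∑_{d | (m,n)} λ(mn/d²)`, one has for `Re(s)` sufficiently large
`(∑ λ(n) n^{-s})³ = ∑_{a,b} μ(a) d₃(b) (ab)^{-2s} ∑_n d₃(n) λ(an) (an)^{-s}`. -/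
theorem hecke_cube_identity (lam : ℕ → ℂ) (hone : lam 1 = 1)
    (hmul : ∀ m n : ℕ, Nat.Coprime m n → lam (m * n) = lam m * lam n)
    (hecke : ∀ m n : ℕ, 0 < m → 0 < n →
      lam m * lam n = ∑ d ∈ (Nat.gcd m n).divisors, lam (m * n / d ^ 2))
    (hgrowth : ∀ n : ℕ, ‖lam n‖ ≤ (n : ℝ) ^ ((1 : ℝ) / 2)) :
    ∃ σ₀ : ℝ, ∀ s : ℂ, σ₀ < s.re →
      (∑' n : ℕ, lam n / (n : ℂ) ^ s) ^ 3
        = ∑' a : ℕ, ∑' b : ℕ,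
            ((ArithmeticFunction.moebius a : ℤ) : ℂ) * (d3 b : ℂ) / ((a * b : ℕ) : ℂ) ^ (2 * s)
              * ∑' n : ℕ, (d3 n : ℂ) * lam (a * n) / ((a * n : ℕ) : ℂ) ^ s := by
  refine ⟨6, fun s hs => ?_⟩
  have hs0 : s ≠ 0 := by rintro rfl; norm_num at hs
  set w : ℕ → ℂ := fun n => ((n : ℂ) ^ s)⁻¹ with hwdef
  have hl : ∀ n, ‖lam n‖ ≤ n := by
    intro n
    refine (hgrowth n).trans ?_
    rcases Nat.eq_zero_or_pos n with rfl | hn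
    · simp
    · calc (n : ℝ) ^ ((1 : ℝ) / 2) ≤ (n : ℝ) ^ (1 : ℝ) :=
            Real.rpow_le_rpow_of_exponent_le (by exact_mod_cast hn) (by norm_num)
        _ = n := Real.rpow_one _
  have hw : ∀ n, ‖w n‖ ≤ qq n ^ 6 := by
    intro n
    rcases Nat.eq_zero_or_pos n with rfl | hn
    · simp [hwdef, qq, Complex.zero_cpow hs0]
    · simp only [hwdef, qq]
      rw [norm_inv, Complex.norm_natCast_cpow_of_pos hn, inv_pow]
      have h1 : (n : ℝ) ^ 6 ≤ (n : ℝ) ^ s.re := by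
        calc (n : ℝ) ^ 6 = (n : ℝ) ^ (6 : ℝ) := by exact_mod_cast (Real.rpow_natCast (n : ℝ) 6).symm
          _ ≤ _ := Real.rpow_le_rpow_of_exponent_le (by exact_mod_cast hn) hs.le
      have : (0 : ℝ) < n := by exact_mod_cast hn
      gcongr
  have hwm : ∀ m n, w (m * n) = w m * w n := by
    intro m n
    simp only [hwdef]
    rw [Nat.cast_mul, Complex.natCast_mul_natCast_cpow, mul_inv]
  have hw2 : ∀ n : ℕ, ((n : ℂ) ^ (2 * s))⁻¹ = w n ^ 2 := by
    intro n
    simp only [hwdef]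
    rw [mul_comm, Complex.cpow_mul_ofNat, inv_pow]
  have hL : ∑' n : ℕ, lam n / (n : ℂ) ^ s = ∑' n, lam n * w n := rfl
  rw [hL, pow_succ, pow_two, step1 hecke hl hw hwm, mul_assoc, step2 hecke hl hw hwm,
    step3 hl hw hwm, ← tsum_mul_left]
  refine tsum_congr fun a => ?_
  rw [tsum_mul_right]
  have h1 : ∑' n : ℕ, (d3 n : ℂ) * lam (a * n) / ((a * n : ℕ) : ℂ) ^ s
      = ∑' n, (d3 n : ℂ) * lam (a * n) * w (a * n) := rfl
  have h2 : ∑' b : ℕ, ((ArithmeticFunction.moebius a : ℤ) : ℂ) * (d3 b : ℂ)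
      / ((a * b : ℕ) : ℂ) ^ (2 * s)
      = ((ArithmeticFunction.moebius a : ℤ) : ℂ) * w a ^ 2 * ∑' b, (d3 b : ℂ) * w b ^ 2 := by
    rw [← tsum_mul_left]
    refine tsum_congr fun b => ?_
    rw [div_eq_mul_inv, hw2, hwm]; ring
  rw [h1, h2, ← step4 hw hwm]
  ring
end
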